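/- Let F be a funnel with base edge [l₁, r₁]. Then there exists a point x on the segment [l₁, r₁] such that x sees every point of F; in particular, every funnel can be guarded by a single point guard placed on its base. -/

import Mathlib

/-- A simple polygon: a cyclic sequence of `n ≥ 3` distinct points in the plane
(`ℝ × ℝ`) whose closed edges `[vtx i, vtx (i+1)]` (indices mod `n`) are pairwise
disjoint, except that consecutive edges share exactly their common endpoint. -/
structure SimplePolygon where
  n : ℕ
  three_le : 3 ≤ n
  vtx : Fin n → ℝ × ℝ
  inj : Function.Injective vtx
  consec_edges : ∀ i : Fin n,
    haveI : NeZero n := ⟨by omega⟩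
    segment ℝ (vtx i) (vtx (i + 1)) ∩ segment ℝ (vtx (i + 1)) (vtx (i + 1 + 1))
      = {vtx (i + 1)}
  nonconsec_edges : ∀ i j : Fin n,
    haveI : NeZero n := ⟨by omega⟩
    i ≠ j → j ≠ i + 1 → i ≠ j + 1 →
      segment ℝ (vtx i) (vtx (i + 1)) ∩ segment ℝ (vtx j) (vtx (j + 1)) = ∅

instance (P : SimplePolygon) : NeZero P.n := ⟨by have := P.three_le; omega⟩

namespace SimplePolygon

/-- The boundary of the polygon: the union of its edges. -/
def boundary (P : SimplePolygon) : Set (ℝ × ℝ) :=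
  ⋃ i : Fin P.n, segment ℝ (P.vtx i) (P.vtx (i + 1))

/-- The polygon as a point set: its boundary together with the union of all
bounded connected components of the complement of the boundary. -/
def region (P : SimplePolygon) : Set (ℝ × ℝ) :=
  P.boundary ∪
    {p | p ∉ P.boundary ∧ Bornology.IsBounded (connectedComponentIn P.boundaryᶜ p)}

/-- `p` sees `q` if the closed segment between them lies in the polygon. -/
def Sees (P : SimplePolygon) (p q : ℝ × ℝ) : Prop :=
  segment ℝ p q ⊆ P.region

/-- The planar cross product of two vectors. -/
def cross2 (a b : ℝ × ℝ) : ℝ := a.1 * b.2 - a.2 * b.1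

/-- Counterclockwise orientation: positive shoelace signed area. -/
def Ccw (P : SimplePolygon) : Prop :=
  0 < ∑ i : Fin P.n, cross2 (P.vtx i) (P.vtx (i + 1))

/-- A vertex is convex if the cross product of the incoming and the outgoing
edge vectors is positive (for a counterclockwise-oriented polygon). -/
def ConvexVtx (P : SimplePolygon) (i : Fin P.n) : Prop :=
  0 < cross2 (P.vtx i - P.vtx (i - 1)) (P.vtx (i + 1) - P.vtx i)

/-- A funnel: a counterclockwise-oriented simple polygon with exactly three
convex vertices, two of which (the endpoints of the base edge) are adjacent;
the third convex vertex is the apex. -/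
def IsFunnel (P : SimplePolygon) : Prop :=
  P.Ccw ∧ ∃ b c : Fin P.n, c ≠ b ∧ c ≠ b + 1 ∧
    {i : Fin P.n | P.ConvexVtx i} = {b, b + 1, c}

/-- `G` is a set of vertices of `P` such that every point of `P` is seen by
some vertex in `G`. -/
def GuardsAll (P : SimplePolygon) (G : Finset (ℝ × ℝ)) : Prop :=
  ↑G ⊆ Set.range P.vtx ∧ ∀ p ∈ P.region, ∃ g ∈ G, P.Sees g p

/-- A vertex-to-point conflict-free chromatic guarding of `P` with `k` colours:
a set `G` of vertices of `P` together with a colouring `χ` (only its values on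
`G` matter) such that every point of `P` sees at least one guard whose colour
is unique among the guards that this point sees. -/
def IsCFGuardV2P (P : SimplePolygon) (G : Finset (ℝ × ℝ)) (k : ℕ)
    (χ : ℝ × ℝ → Fin k) : Prop :=
  ↑G ⊆ Set.range P.vtx ∧
  ∀ p ∈ P.region, ∃ g ∈ G, P.Sees g p ∧
    ∀ h ∈ G, h ≠ g → P.Sees h p → χ h ≠ χ g

/-- A vertex-to-vertex conflict-free chromatic guarding of `P` with `k`
colours: every vertex of `P` sees at least one guard whose colour is unique
among the guards that this vertex sees. -/
def IsCFGuardV2V (P : SimplePolygon) (G : Finset (ℝ × ℝ)) (k : ℕ)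
    (χ : ℝ × ℝ → Fin k) : Prop :=
  ↑G ⊆ Set.range P.vtx ∧
  ∀ i : Fin P.n, ∃ g ∈ G, P.Sees g (P.vtx i) ∧
    ∀ h ∈ G, h ≠ g → P.Sees h (P.vtx i) → χ h ≠ χ g

end SimplePolygon




namespace FP
open Complex

/-- planar cross product on `ℂ` -/
def cr (a b : ℂ) : ℝ := a.re * b.im - a.im * b.re

/-- lexicographic positivity: argument in `[0, π)` -/
def LexPos (z : ℂ) : Prop := 0 < z.im ∨ (z.im = 0 ∧ 0 < z.re)

theorem div_im_cr (a b : ℂ) : (b / a).im = cr a b / normSq a := by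
  rw [div_im, cr]; ring

theorem div_re_in (a b : ℂ) : (b / a).re = (a.re * b.re + a.im * b.im) / normSq a := by
  rw [div_re]; ring

theorem slit_of_cr_ne {a b : ℂ} (h : cr a b ≠ 0) : b / a ∈ slitPlane := by
  rw [mem_slitPlane_iff]; right
  rw [div_im_cr]
  have ha : a ≠ 0 := by rintro rfl; simp [cr] at h
  exact div_ne_zero h (normSq_pos.2 ha).ne'

theorem slit_inv {a b : ℂ} (h : b / a ∈ slitPlane) : a / b ∈ slitPlane := by
  have := mem_slitPlane_iff_arg.1 h
  rw [mem_slitPlane_iff_arg]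
  have e : a / b = (b / a)⁻¹ := by simp
  rw [e, arg_inv, if_neg this.1]
  refine ⟨fun h2 => ?_, inv_ne_zero this.2⟩
  have := (arg_mem_Ioc (b / a)).1
  linarith

/-- not in slit plane: real non positive ratio -/
theorem not_slit {z : ℂ} (h : z ∉ slitPlane) : ∃ t : ℝ, 0 ≤ t ∧ z = -(t : ℂ) := by
  rw [mem_slitPlane_iff] at h
  push Not at h
  refine ⟨-z.re, by linarith [h.1], ?_⟩
  apply Complex.ext <;> simp [h.2]

theorem slit_of_not_mem_segment {p a b : ℂ} (h : p ∉ segment ℝ a b) :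
    (b - p) / (a - p) ∈ slitPlane := by
  by_contra hs
  obtain ⟨t, ht, he⟩ := not_slit hs
  have ha : a - p ≠ 0 := by
    intro h0
    apply h
    rw [sub_eq_zero.1 h0]; exact left_mem_segment ℝ p b
  rw [div_eq_iff ha] at he
  apply h
  refine ⟨t / (1 + t), 1 / (1 + t), by positivity, by positivity, by field_simp; ring, ?_⟩
  have h1 : (1 + (t : ℂ)) ≠ 0 := by
    exact_mod_cast (by positivity : (1 + t) ≠ 0)
  simp only [real_smul]
  push_cast
  field_simp
  linear_combination he

theorem coe_sum_angle {ι : Type*} (s : Finset ι) (f : ι → ℝ) :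
    ((∑ i ∈ s, f i : ℝ) : Real.Angle) = ∑ i ∈ s, (f i : Real.Angle) :=
  map_sum Real.Angle.coeHom f s

/-- continuous function with values in `2πℤ` on a preconnected set is constant -/
theorem const_of_angle {X : Type*} [TopologicalSpace X] {S : Set X} (hS : IsPreconnected S)
    {f : X → ℝ} (hf : ContinuousOn f S) (h : ∀ x ∈ S, (f x : Real.Angle) = 0)
    {x y : X} (hx : x ∈ S) (hy : y ∈ S) : f x = f y := by
  have hintg : ∀ x ∈ S, ∃ k : ℤ, f x = k * (2 * Real.pi) := by
    intro x hx
    obtain ⟨k, hk⟩ := Real.Angle.coe_eq_zero_iff.1 (h x hx)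
    exact ⟨k, by rw [← hk]; simp⟩
  have hpi := Real.pi_pos
  by_contra hne
  wlog hlt : f x < f y generalizing x y
  · exact this hy hx (Ne.symm hne) (lt_of_le_of_ne (not_lt.1 hlt) (Ne.symm hne))
  obtain ⟨k, hk⟩ := hintg x hx
  obtain ⟨l, hl⟩ := hintg y hy
  have hkl : k < l := by
    by_contra hc
    have : (l : ℝ) ≤ k := by exact_mod_cast not_lt.1 hc
    rw [hk, hl] at hlt
    nlinarith
  have hkl' : (k : ℝ) + 1 ≤ l := by exact_mod_cast hkl
  have hm : (k + 1 / 2 : ℝ) * (2 * Real.pi) ∈ f '' S := by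
    apply hS.intermediate_value hx hy hf
    rw [hk, hl]
    constructor <;> nlinarith
  obtain ⟨z, hz, hfz⟩ := hm
  obtain ⟨m, hm⟩ := hintg z hz
  rw [hm] at hfz
  have h2 : (m : ℝ) = k + 1 / 2 := by
    have : (2 * Real.pi) ≠ 0 := by positivity
    exact mul_right_cancel₀ this hfz
  have h3 : (2 * m : ℤ) = 2 * k + 1 := by
    have : (2 * m : ℝ) = 2 * k + 1 := by linarith
    exact_mod_cast this
  omega

theorem eq_zero_of_angle {x : ℝ} (h : (x : Real.Angle) = 0) (h1 : -(2 * Real.pi) < x)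
    (h2 : x < 2 * Real.pi) : x = 0 := by
  obtain ⟨k, hk⟩ := Real.Angle.coe_eq_zero_iff.1 h
  have hpi := Real.pi_pos
  have hk' : x = k * (2 * Real.pi) := by rw [← hk]; simp
  rw [hk'] at h1 h2
  have a1 : (-1 : ℝ) < k := by nlinarith
  have a2 : (k : ℝ) < 1 := by nlinarith
  have b1 : -1 < k := by exact_mod_cast a1
  have b2 : k < 1 := by exact_mod_cast a2
  have : k = 0 := by omega
  rw [hk', this]; simp

/-- abstract simple polygons, as periodic sequences -/
structure Poly (n : ℕ) (v : ℕ → ℂ) : Prop where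
  hn : 3 ≤ n
  per : ∀ i, v (i + n) = v i
  nospike : ∀ i, (v (i + 2) - v (i + 1)) / (v (i + 1) - v i) ∈ slitPlane
  nonadj : ∀ i k, 2 ≤ k → k + 2 ≤ n →
    Disjoint (segment ℝ (v i) (v (i + 1))) (segment ℝ (v (i + k)) (v (i + k + 1)))

theorem Poly.shift {n : ℕ} {v : ℕ → ℂ} (h : Poly n v) (j : ℕ) : Poly n (fun i => v (j + i)) where
  hn := h.hn
  per i := by rw [← add_assoc]; exact h.per _
  nospike i := h.nospike (j + i)
  nonadj i k h1 h2 := by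
    have := h.nonadj (j + i) k h1 h2
    simpa only [add_assoc] using this

theorem Poly.edge_ne {n : ℕ} {v : ℕ → ℂ} (h : Poly n v) (i : ℕ) : v (i + 1) - v i ≠ 0 := by
  intro h0
  have := h.nospike i
  rw [h0] at this
  simp at this

/-- the constant attached to a simple polygon (computed at vertex 0) -/
noncomputable def cv (n : ℕ) (v : ℕ → ℂ) : ℝ :=
  Real.pi + arg ((v 1 - v 0) / (v n - v (n - 1))) +
    ∑ i ∈ Finset.range (n - 2), arg ((v (i + 2) - v 0) / (v (i + 1) - v 0))

/-- auxiliary function along edge 0 -/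
noncomputable def gf (m : ℕ) (v : ℕ → ℂ) (p : ℂ) : ℝ :=
  Real.pi + arg ((v 1 - v 0) / (p - v (m + 2))) + arg ((v 2 - p) / (v 1 - v 0)) +
    ∑ i ∈ Finset.range m, arg ((v (i + 3) - p) / (v (i + 2) - p))

theorem angle_telescope (w : ℕ → ℂ) (hw : ∀ i, w i ≠ 0) (m : ℕ) :
    ((∑ i ∈ Finset.range m, arg (w (i + 1) / w i) : ℝ) : Real.Angle) =
      (arg (w m) : Real.Angle) - arg (w 0) := by
  rw [coe_sum_angle, ← Finset.sum_range_sub (fun i => (arg (w i) : Real.Angle))]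
  refine Finset.sum_congr rfl fun i _ => ?_
  rw [arg_div_coe_angle (hw _) (hw _)]

theorem angle_telescope' (w : ℕ → ℂ) (m : ℕ) (hw : ∀ i ≤ m, w i ≠ 0) :
    ((∑ i ∈ Finset.range m, arg (w (i + 1) / w i) : ℝ) : Real.Angle) =
      (arg (w m) : Real.Angle) - arg (w 0) := by
  rw [coe_sum_angle, ← Finset.sum_range_sub (fun i => (arg (w i) : Real.Angle))]
  refine Finset.sum_congr rfl fun i hi => ?_
  have := Finset.mem_range.1 hi
  rw [arg_div_coe_angle (hw _ (by omega)) (hw _ (by omega))]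

theorem gf_const {m : ℕ} {v : ℕ → ℂ} (h : Poly (m + 3) v) {s t : ℝ} (hs : s ∈ Set.Icc (0:ℝ) 1)
    (ht : t ∈ Set.Icc (0:ℝ) 1) :
    gf m v (v 0 + s * (v 1 - v 0)) = gf m v (v 0 + t * (v 1 - v 0)) := by
  have hd0 : v 1 - v 0 ≠ 0 := h.edge_ne 0
  have hp0 : v (m + 3) = v 0 := by simpa using h.per 0
  have hp1 : v (m + 4) = v 1 := by
    have := h.per 1
    rwa [show 1 + (m + 3) = m + 4 by ring] at this
  -- slit facts
  have s1 : ∀ s ∈ Set.Icc (0:ℝ) 1,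
      (v 1 - v 0) / ((v 0 + s * (v 1 - v 0)) - v (m + 2)) ∈ slitPlane := by
    intro s hs
    apply slit_inv
    have := slit_inv (h.nospike (m + 2))
    rw [show m + 2 + 2 = m + 4 by ring, show m + 2 + 1 = m + 3 by ring, hp0, hp1] at this
    have e : (v 0 + s * (v 1 - v 0) - v (m + 2)) / (v 1 - v 0) =
      (v 0 - v (m + 2)) / (v 1 - v 0) + (s : ℂ) := by field_simp; ring
    rw [e]
    rw [mem_slitPlane_iff] at this ⊢
    simp only [add_re, ofReal_re, add_im, ofReal_im, add_zero]
    rcases this with h1 | h1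
    · left; linarith [hs.1]
    · right; exact h1
  have s2 : ∀ s ∈ Set.Icc (0:ℝ) 1,
      (v 2 - (v 0 + s * (v 1 - v 0))) / (v 1 - v 0) ∈ slitPlane := by
    intro s hs
    have := h.nospike 0
    simp only [zero_add] at this
    have e : (v 2 - (v 0 + s * (v 1 - v 0))) / (v 1 - v 0) =
      (v 2 - v 1) / (v 1 - v 0) + ((1 - s : ℝ) : ℂ) := by push_cast; field_simp; ring
    rw [e]
    rw [mem_slitPlane_iff] at this ⊢
    simp only [add_re, ofReal_re, add_im, ofReal_im, add_zero]
    rcases this with h1 | h1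
    · left; linarith [hs.2]
    · right; exact h1
  have hseg : ∀ s ∈ Set.Icc (0:ℝ) 1, v 0 + s * (v 1 - v 0) ∈ segment ℝ (v 0) (v 1) := by
    intro s hs
    rw [segment_eq_image']
    exact ⟨s, hs, by simp⟩
  have s3 : ∀ i < m, ∀ s ∈ Set.Icc (0:ℝ) 1,
      (v (i + 3) - (v 0 + s * (v 1 - v 0))) / (v (i + 2) - (v 0 + s * (v 1 - v 0))) ∈ slitPlane := by
    intro i hi s hs
    apply slit_of_not_mem_segment
    intro hmem
    have := h.nonadj 0 (i + 2) (by omega) (by omega)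
    simp only [zero_add] at this
    exact Set.disjoint_left.1 this (hseg s hs) hmem
  refine const_of_angle (f := fun s : ℝ => gf m v (v 0 + s * (v 1 - v 0)))
    (isPreconnected_Icc (a := (0:ℝ)) (b := 1)) ?_ ?_ hs ht
  · have nz : ∀ {a b : ℂ}, a / b ∈ slitPlane → b ≠ 0 := by
      rintro a b h rfl
      simp at h
    unfold gf
    intro s hs
    apply ContinuousAt.continuousWithinAt
    refine ((continuousAt_const.add ?_).add ?_).add ?_
    · refine ContinuousAt.comp (f := fun s : ℝ => (v 1 - v 0) / ((v 0 + s * (v 1 - v 0)) - v (m + 2)))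
        (continuousAt_arg (s1 s hs)) ?_
      exact ContinuousAt.div (by fun_prop) (by fun_prop) (nz (s1 s hs))
    · refine ContinuousAt.comp (f := fun s : ℝ => (v 2 - (v 0 + s * (v 1 - v 0))) / (v 1 - v 0))
        (continuousAt_arg (s2 s hs)) ?_
      fun_prop
    · refine tendsto_finsetSum _ fun i hi => ?_
      have hi := Finset.mem_range.1 hi
      refine ContinuousAt.comp (f := fun s : ℝ => (v (i + 3) - (v 0 + s * (v 1 - v 0))) / (v (i + 2) - (v 0 + s * (v 1 - v 0))))
        (continuousAt_arg (s3 i hi s hs)) ?_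
      exact ContinuousAt.div (by fun_prop) (by fun_prop) (nz (s3 i hi s hs))
  · intro s hs
    set p := v 0 + s * (v 1 - v 0) with hp
    have n1 : p - v (m + 2) ≠ 0 := by
      intro h0
      have := s1 s hs
      rw [← hp, h0] at this; simp at this
    have n2 : v 2 - p ≠ 0 := by
      intro h0
      have := s2 s hs
      rw [← hp, h0] at this; simp at this
    have n3 : ∀ i ≤ m, v (i + 2) - p ≠ 0 := by
      intro i hi h0
      rcases hi.lt_or_eq with hi | rfl
      · have := s3 i hi s hs
        rw [← hp, h0] at this; simp at this
      · apply n1; rw [← neg_sub, h0]; simp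
    have tel := angle_telescope' (fun i => v (i + 2) - p) m n3
    have e3 : v (m + 2) - p = -(p - v (m + 2)) := by ring
    unfold gf
    rw [Real.Angle.coe_add, Real.Angle.coe_add, Real.Angle.coe_add]
    rw [show (∑ i ∈ Finset.range m, ((v (i + 3) - p) / (v (i + 2) - p)).arg) =
      ∑ i ∈ Finset.range m, ((v (i + 1 + 2) - p) / (v (i + 2) - p)).arg from rfl, tel,
      arg_div_coe_angle hd0 n1, arg_div_coe_angle n2 hd0, e3, arg_neg_coe_angle n1]
    have h2 : (Real.pi : Real.Angle) + Real.pi = 0 := by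
      rw [← Real.Angle.coe_add]; 
      exact Real.Angle.coe_eq_zero_iff.2 ⟨1, by simp; ring⟩
    have e0 : (v (0 + 2) - p) = v 2 - p := rfl
    try rw [e0]
    calc _ = ((Real.pi : Real.Angle) + Real.pi) := by abel
      _ = 0 := h2

theorem gf_zero (m : ℕ) (v : ℕ → ℂ) (hp : v (m + 3) = v 0) : gf m v (v 0) = cv (m + 3) v := by
  unfold gf cv
  rw [show m + 3 - 1 = m + 2 by omega, show m + 3 - 2 = m + 1 by omega, hp,
    Finset.sum_range_succ']
  simp only [zero_add, add_assoc]
  congr 2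
  rw [add_comm]

theorem gf_one (m : ℕ) (v : ℕ → ℂ) (hp : ∀ i, v (i + (m + 3)) = v i) :
    gf m v (v 1) = cv (m + 3) (fun i => v (i + 1)) := by
  have h0 := hp 0
  have h1 := hp 1
  rw [show 1 + (m + 3) = m + 3 + 1 by ring] at h1
  rw [zero_add] at h0
  unfold gf cv
  rw [show m + 3 - 1 = m + 2 by omega, show m + 3 - 2 = m + 1 by omega,
    Finset.sum_range_succ]
  simp only [h1]
  rw [show m + 1 + 1 = m + 2 by ring, show m + 2 + 1 = m + 3 by ring]
  simp only [h0, zero_add, add_assoc, one_add_one_eq_two]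
  norm_num only
  rw [← neg_sub (v 1) (v 0), ← neg_sub (v 1) (v (m + 2)), neg_div_neg_eq]
  ring

theorem cv_succ {n : ℕ} {v : ℕ → ℂ} (h : Poly n v) : cv n (fun i => v (i + 1)) = cv n v := by
  obtain ⟨m, rfl⟩ : ∃ m, n = m + 3 := ⟨n - 3, by have := h.hn; omega⟩
  rw [← gf_zero m v (by simpa using h.per 0), ← gf_one m v h.per]
  have := gf_const h (s := 1) (t := 0) (by simp) (by simp)
  simpa using this

theorem cv_shift {n : ℕ} {v : ℕ → ℂ} (h : Poly n v) (j : ℕ) :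
    cv n (fun i => v (j + i)) = cv n v := by
  induction j with
  | zero => simp
  | succ j ih =>
    rw [← ih, ← cv_succ (h.shift j)]
    congr 1
    funext i
    congr 1
    ring

/-- value of the constant at interior points of an edge -/
theorem cv_edge {n : ℕ} {v : ℕ → ℂ} (h : Poly n v) {s : ℝ} (h0 : 0 < s) (h1 : s < 1) {p : ℂ}
    (hp : p = v 0 + s * (v 1 - v 0)) :
    cv n v = Real.pi + ∑ i ∈ Finset.range (n - 1), arg ((v (i + 2) - p) / (v (i + 1) - p)) := by
  obtain ⟨m, rfl⟩ : ∃ m, n = m + 3 := ⟨n - 3, by have := h.hn; omega⟩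
  have hp0 : v (m + 3) = v 0 := by simpa using h.per 0
  have hg := gf_const h (s := 0) (t := s) (by simp) ⟨h0.le, h1.le⟩
  rw [← hp] at hg
  simp only [ofReal_zero, zero_mul, add_zero] at hg
  rw [← gf_zero m v hp0, hg, show m + 3 - 1 = m + 1 + 1 by omega, Finset.sum_range_succ,
    Finset.sum_range_succ']
  unfold gf
  have a1 : arg ((v (m + 1 + 2) - p) / (v (m + 1 + 1) - p)) =
      arg ((v 1 - v 0) / (p - v (m + 2))) := by
    rw [show m + 1 + 2 = m + 3 by ring, show m + 1 + 1 = m + 2 by ring, hp0,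
      ← arg_real_mul ((v 1 - v 0) / (p - v (m + 2))) h0]
    congr 1
    rw [← neg_sub p (v 0), ← neg_sub p (v (m + 2)), neg_div_neg_eq, hp]
    ring
  have a2 : arg ((v (0 + 2) - p) / (v (0 + 1) - p)) = arg ((v 2 - p) / (v 1 - v 0)) := by
    have hs : 0 < (1 - s) := by linarith
    rw [← arg_real_mul ((v (0 + 2) - p) / (v (0 + 1) - p)) hs]
    congr 1
    have e : v (0 + 1) - p = ((1 - s : ℝ) : ℂ) * (v 1 - v 0) := by
      rw [hp]; push_cast; ring
    have hz : ((1 - s : ℝ) : ℂ) ≠ 0 := by exact_mod_cast hs.ne'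
    rw [e]
    field_simp
  rw [a1, a2]
  simp only [add_assoc]
  norm_num only
  ring

end FP


namespace FP
open Complex

theorem LexPos.ne {z : ℂ} (h : LexPos z) : z ≠ 0 := by
  rintro rfl
  rcases h with h | h <;> simp at h

theorem LexPos.nonneg {z : ℂ} (h : LexPos z) : 0 ≤ arg z := by
  rw [arg_nonneg_iff]
  rcases h with h | h
  · exact h.le
  · exact h.1.ge

theorem LexPos.lt_pi {z : ℂ} (h : LexPos z) : arg z < Real.pi := by
  rw [arg_lt_pi_iff]
  rcases h with h | h
  · exact Or.inr h.ne'
  · exact Or.inl h.2.le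

theorem LexPos.add {z w : ℂ} (h : LexPos z) (h' : LexPos w) : LexPos (z + w) := by
  unfold LexPos at *
  simp only [add_im, add_re]
  rcases h with h | h <;> rcases h' with h' | h'
  · left; linarith
  · left; linarith
  · left; linarith
  · right; constructor <;> linarith

theorem LexPos.smul {z : ℂ} (h : LexPos z) {t : ℝ} (ht : 0 < t) : LexPos (t * z) := by
  unfold LexPos at *
  simp only [re_ofReal_mul, im_ofReal_mul]
  rcases h with h | h
  · left; positivity
  · right; exact ⟨by rw [h.1]; simp, mul_pos ht h.2⟩

theorem arg_div_lex {z w : ℂ} (hz : LexPos z) (hw : LexPos w) : arg (w / z) = arg w - arg z := by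
  have h1 : ((arg (w / z) - (arg w - arg z) : ℝ) : Real.Angle) = 0 := by
    rw [Real.Angle.coe_sub, Real.Angle.coe_sub, arg_div_coe_angle hw.ne hz.ne, sub_self]
  have := arg_mem_Ioc (w / z)
  have a1 := hz.nonneg
  have a2 := hz.lt_pi
  have a3 := hw.nonneg
  have a4 := hw.lt_pi
  have := eq_zero_of_angle h1 (by linarith [this.1]) (by linarith [this.2])
  linarith

theorem hull_sign {n : ℕ} {v : ℕ → ℂ} (h : Poly n v) (ω : ℂ)
    (hl : ∀ i, 1 ≤ i → i < n → LexPos ((v i - v 0) / ω)) :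
    (cv n v = 2 * Real.pi ∧ 0 < cr (v n - v (n - 1)) (v 1 - v 0)) ∨
    (cv n v = 0 ∧ cr (v n - v (n - 1)) (v 1 - v 0) < 0) := by
  obtain ⟨m, rfl⟩ : ∃ m, n = m + 3 := ⟨n - 3, by have := h.hn; omega⟩
  have hp0 : v (m + 3) = v 0 := by simpa using h.per 0
  have hp1 : v (m + 4) = v 1 := by
    have := h.per 1
    rwa [show 1 + (m + 3) = m + 4 by ring] at this
  have hω : ω ≠ 0 := by
    rintro rfl
    have := (hl 1 le_rfl (by omega)).ne
    simp at this
  have hsum : ∑ i ∈ Finset.range (m + 1), arg ((v (i + 2) - v 0) / (v (i + 1) - v 0)) =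
      arg ((v (m + 2) - v 0) / ω) - arg ((v 1 - v 0) / ω) := by
    have := Finset.sum_range_sub (fun i => arg ((v (i + 1) - v 0) / ω)) (m + 1)
    simp only [add_assoc, zero_add] at this
    norm_num only at this
    rw [← this]
    refine Finset.sum_congr rfl fun i hi => ?_
    have hi := Finset.mem_range.1 hi
    rw [← arg_div_lex (hl (i + 1) (by omega) (by omega)) (hl (i + 2) (by omega) (by omega))]
    congr 1
    field_simp
  set q := (v 1 - v 0) / ω / ((v (m + 2) - v 0) / ω) with hq
  have hqarg : arg q = arg ((v 1 - v 0) / ω) - arg ((v (m + 2) - v 0) / ω) :=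
    arg_div_lex (hl (m + 2) (by omega) (by omega)) (hl 1 (by omega) (by omega))
  have hqe : (v 1 - v 0) / (v (m + 3) - v (m + 2)) = -q := by
    rw [hq, hp0, ← neg_sub (v (m + 2)) (v 0), div_neg]
    field_simp
  have hsp : -q ∈ slitPlane := by
    rw [← hqe]
    have := h.nospike (m + 2)
    rw [show m + 2 + 2 = m + 4 by ring, show m + 2 + 1 = m + 3 by ring, hp1] at this
    rwa [hp0] at this ⊢
  have hd : v (m + 3) - v (m + 2) ≠ 0 := h.edge_ne (m + 2)
  have hns := normSq_pos.2 hd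
  have him := div_im_cr (v (m + 3) - v (m + 2)) (v 1 - v 0)
  rw [hqe, eq_div_iff hns.ne', neg_im] at him
  have hcv : cv (m + 3) v = Real.pi + arg (-q) - arg q := by
    unfold cv
    rw [show m + 3 - 1 = m + 2 by omega, show m + 3 - 2 = m + 1 by omega, hsum, hqe, hqarg]
    ring
  rw [hcv, show m + 3 - 1 = m + 2 by omega, ← him]
  rcases lt_trichotomy q.im 0 with hi | hi | hi
  · left
    rw [arg_neg_eq_arg_add_pi_of_im_neg hi]
    exact ⟨by ring, by nlinarith⟩
  · exfalso
    rw [mem_slitPlane_iff] at hsp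
    simp [hi] at hsp
    have : arg q = Real.pi := arg_eq_pi_iff.2 ⟨hsp, hi⟩
    have a1 := (hl 1 (by omega) (by omega)).lt_pi
    have a2 := (hl (m + 2) (by omega) (by omega)).nonneg
    linarith
  · right
    rw [arg_neg_eq_arg_sub_pi_of_im_pos hi]
    exact ⟨by ring, by nlinarith⟩

theorem Poly.inj' {n : ℕ} {v : ℕ → ℂ} (h : Poly n v) {i k : ℕ} (h1 : 1 ≤ k) (h2 : k < n) :
    v (i + k) ≠ v i := by
  intro he
  rcases Nat.lt_or_ge k 2 with hk | hk
  · have : k = 1 := by omega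
    subst this
    exact h.edge_ne i (by rw [he]; simp)
  · rcases Nat.lt_or_ge n (k + 2) with hk2 | hk2
    · have : k + 1 = n := by omega
      have h3 := h.edge_ne (i + k)
      apply h3
      rw [add_assoc, this, h.per, he, sub_self]
    · refine Set.disjoint_left.1 (h.nonadj i k hk hk2) (left_mem_segment ℝ _ _) ?_
      rw [← he]
      exact left_mem_segment ℝ _ _

/-- lexicographic minimum of the vertices in a frame -/
theorem exists_lexmin {n : ℕ} {v : ℕ → ℂ} (h : Poly n v) {ω : ℂ} (hω : ω ≠ 0) :
    ∃ j < n, ∀ i, 1 ≤ i → i < n → LexPos ((v (j + i) - v j) / ω) := by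
  have hn := h.hn
  obtain ⟨j, hj, hmin⟩ := Finset.exists_min_image (Finset.range n)
    (fun i => toLex ((v i / ω).im, (v i / ω).re)) ⟨0, by simp; omega⟩
  have hj := Finset.mem_range.1 hj
  refine ⟨j, hj, fun i h1 h2 => ?_⟩
  have hne := h.inj' (i := j) h1 h2
  obtain ⟨l, hl, hvl⟩ : ∃ l < n, v l = v (j + i) := by
    rcases Nat.lt_or_ge (j + i) n with h3 | h3
    · exact ⟨j + i, h3, rfl⟩
    · refine ⟨j + i - n, by omega, ?_⟩
      rw [← h.per]; congr 1; omega
  have := hmin l (Finset.mem_range.2 hl)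
  rw [hvl, Prod.Lex.toLex_le_toLex] at this
  rw [sub_div]
  unfold LexPos
  simp only [sub_im, sub_re]
  simp only at this
  rcases this with h3 | ⟨h3, h4⟩
  · left; linarith
  · right
    refine ⟨by linarith, ?_⟩
    rcases h4.lt_or_eq with h5 | h5
    · linarith
    · exfalso
      apply hne
      have : v j / ω = v (j + i) / ω := Complex.ext h5 h3
      rw [div_left_inj' hω] at this
      exact this.symm

theorem hull_sign_shift {n : ℕ} {v : ℕ → ℂ} (h : Poly n v) (j : ℕ) (ω : ℂ)
    (hl : ∀ i, 1 ≤ i → i < n → LexPos ((v (j + i) - v j) / ω)) :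
    (cv n v = 2 * Real.pi ∧ 0 < cr (v j - v (j + (n - 1))) (v (j + 1) - v j)) ∨
    (cv n v = 0 ∧ cr (v j - v (j + (n - 1))) (v (j + 1) - v j) < 0) := by
  have := hull_sign (h.shift j) ω hl
  rw [cv_shift h j] at this
  simp only [h.per] at this
  exact this

/-- build a polygon from a finite list of vertices -/
theorem Poly.mk' {N : ℕ} {w : ℕ → ℂ} (hN : 3 ≤ N)
    (hs : ∀ i, i + 2 < N → (w (i + 2) - w (i + 1)) / (w (i + 1) - w i) ∈ slitPlane)
    (hs1 : (w 0 - w (N - 1)) / (w (N - 1) - w (N - 2)) ∈ slitPlane)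
    (hs2 : (w 1 - w 0) / (w 0 - w (N - 1)) ∈ slitPlane)
    (hd : ∀ a b, a + 2 ≤ b → b + 1 < N →
      Disjoint (segment ℝ (w a) (w (a + 1))) (segment ℝ (w b) (w (b + 1))))
    (hd1 : ∀ a, 1 ≤ a → a + 2 < N →
      Disjoint (segment ℝ (w a) (w (a + 1))) (segment ℝ (w (N - 1)) (w 0))) :
    Poly N (fun i => w (i % N)) := by
  have key : ∀ a b, a + 2 ≤ b → b < N → ¬ (a = 0 ∧ b = N - 1) →
      Disjoint (segment ℝ (w a) (w ((a + 1) % N))) (segment ℝ (w b) (w ((b + 1) % N))) := by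
    intro a b hab hb hne
    rw [Nat.mod_eq_of_lt (by omega : a + 1 < N)]
    rcases Nat.lt_or_ge (b + 1) N with h | h
    · rw [Nat.mod_eq_of_lt h]
      exact hd a b hab h
    · have : b = N - 1 := by omega
      subst this
      rw [show N - 1 + 1 = N by omega, Nat.mod_self]
      exact hd1 a (by omega) (by omega)
  have wrap : ∀ i k, k ≤ N → (i + k) % N = if i % N + k < N then i % N + k else i % N + k - N := by
    intro i k hk
    have hlt : i % N < N := Nat.mod_lt _ (by omega)
    rw [← Nat.mod_add_mod]
    split_ifs with h
    · exact Nat.mod_eq_of_lt h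
    · rw [Nat.mod_eq_sub_mod (by omega)]
      rcases (show i % N + k - N < N ∨ i % N + k - N = N by omega) with h2 | h2
      · exact Nat.mod_eq_of_lt h2
      · omega
  refine ⟨hN, fun i => by simp, fun i => ?_, fun i k h1 h2 => ?_⟩
  · have hlt : i % N < N := Nat.mod_lt _ (by omega)
    rw [wrap i 2 (by omega), wrap i 1 (by omega)]
    generalize i % N = a at *
    rcases (show a + 2 < N ∨ a = N - 2 ∨ a = N - 1 by omega) with h | h | h
    · rw [if_pos h, if_pos (by omega)]
      exact hs a h
    · subst h
      rw [if_neg (by omega), if_pos (by omega), show N - 2 + 2 - N = 0 by omega,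
        show N - 2 + 1 = N - 1 by omega]
      exact hs1
    · subst h
      rw [if_neg (by omega), if_neg (by omega), show N - 1 + 2 - N = 1 by omega,
        show N - 1 + 1 - N = 0 by omega]
      exact hs2
  · have hlt : i % N < N := Nat.mod_lt _ (by omega)
    have e1 : (i + 1) % N = (i % N + 1) % N := by simp
    have e2 : (i + k + 1) % N = ((i + k) % N + 1) % N := by simp
    rw [e1, e2, wrap i k (by omega)]
    generalize i % N = a at *
    split_ifs with h
    · exact key a (a + k) (by omega) h (by omega)
    · exact (key (a + k - N) a (by omega) hlt (by omega)).symm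

end FP


namespace FP
open Complex

/-- reflex chain: vertices `u 0, …, u k` -/
structure Chain (k : ℕ) (u : ℕ → ℂ) : Prop where
  ne : ∀ i < k, u (i + 1) ≠ u i
  turn : ∀ i, i + 2 ≤ k → cr (u (i + 1) - u i) (u (i + 2) - u (i + 1)) ≤ 0
  nospike : ∀ i, i + 2 ≤ k → (u (i + 2) - u (i + 1)) / (u (i + 1) - u i) ∈ slitPlane
  nonadj : ∀ i j, i + 2 ≤ j → j + 1 ≤ k →
    Disjoint (segment ℝ (u i) (u (i + 1))) (segment ℝ (u j) (u (j + 1)))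

theorem Chain.initial {k : ℕ} {u : ℕ → ℂ} (h : Chain k u) {j : ℕ} (hj : j ≤ k) : Chain j u where
  ne i hi := h.ne i (by omega)
  turn i hi := h.turn i (by omega)
  nospike i hi := h.nospike i (by omega)
  nonadj i l h1 h2 := h.nonadj i l h1 (by omega)

theorem Chain.inj {k : ℕ} {u : ℕ → ℂ} (h : Chain k u) {i j : ℕ} (hij : i < j) (hj : j < k) :
    u j ≠ u i := by
  intro he
  rcases Nat.lt_or_ge j (i + 2) with h2 | h2
  · have : j = i + 1 := by omega
    subst this
    exact h.ne i (by omega) he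
  · refine Set.disjoint_left.1 (h.nonadj i j h2 (by omega)) (left_mem_segment ℝ _ _) ?_
    rw [← he]; exact left_mem_segment ℝ _ _

/-- the vertex seen first (angularly, then by distance) from the end of the chain -/
theorem exists_first (J : ℕ) (hJ : 0 < J) (z : ℕ → ℂ) (δ : ℂ)
    (hl : ∀ i < J, LexPos (z i / δ)) :
    ∃ i0 < J, ∀ i < J, LexPos (z i / z i0 - 1) ∨ z i = z i0 := by
  obtain ⟨i0, hi0, hmin⟩ := Finset.exists_min_image (Finset.range J)
    (fun i => toLex (arg (z i / δ), ‖z i‖)) ⟨0, by simpa⟩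
  have hi0 := Finset.mem_range.1 hi0
  have hδ : δ ≠ 0 := by
    rintro rfl
    have := (hl 0 hJ).ne
    simp at this
  refine ⟨i0, hi0, fun i hi => ?_⟩
  have := hmin i (Finset.mem_range.2 hi)
  rw [Prod.Lex.toLex_le_toLex] at this
  have l1 := hl i hi
  have l0 := hl i0 hi0
  have hz0 : z i0 ≠ 0 := by
    intro h; rw [h] at l0; exact l0.ne (by simp)
  have hz : z i ≠ 0 := by
    intro h; rw [h] at l1; exact l1.ne (by simp)
  have hq : z i / δ / (z i0 / δ) = z i / z i0 := by field_simp
  have harg := arg_div_lex l0 l1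
  rw [hq] at harg
  rcases this with h3 | ⟨h3, h4⟩
  · left; left
    simp only [sub_im, one_im, sub_zero]
    simp only at h3
    have h5 : 0 < arg (z i / z i0) := by linarith
    have h6 : arg (z i / z i0) < Real.pi := by linarith [l0.nonneg, l1.lt_pi]
    have h7 := arg_nonneg_iff.1 h5.le
    rcases h7.lt_or_eq with h8 | h8
    · exact h8
    · exfalso
      rcases arg_lt_pi_iff.1 h6 with h9 | h9
      · have := arg_eq_zero_iff.2 ⟨h9, h8.symm⟩
        linarith
      · exact h9 h8.symm
  · simp only at h3 h4
    have h5 : arg (z i / z i0) = 0 := by linarith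
    obtain ⟨h6, h7⟩ := arg_eq_zero_iff.1 h5
    set t := (z i / z i0).re with ht
    have hzt : z i / z i0 = (t : ℂ) := by
      apply Complex.ext
      · simp [ht]
      · simp [h7]
    have hn : ‖z i / z i0‖ = t := by rw [hzt, norm_real, Real.norm_of_nonneg h6]
    rw [norm_div] at hn
    have ht1 : 1 ≤ t := by
      rw [← hn, one_le_div (norm_pos_iff.2 hz0)]; exact h4
    rcases ht1.lt_or_eq with h8 | h8
    · left; right
      rw [hzt]
      simp [h8]
    · right
      rw [← h8, ofReal_one, div_eq_one_iff_eq hz0] at hzt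
      exact hzt

theorem lexpos_seg {a b p e : ℂ} (ha : LexPos (a / e - 1)) (hb : LexPos (b / e - 1))
    {s t : ℝ} (hs : 0 ≤ s) (ht : 0 ≤ t) (hst : s + t = 1) (hp : p = s * a + t * b) :
    LexPos (p / e - 1) := by
  have e1 : p / e - 1 = s * (a / e - 1) + t * (b / e - 1) := by
    have : (s : ℂ) + t = 1 := by exact_mod_cast hst
    rw [hp]
    linear_combination this
  rw [e1]
  rcases hs.lt_or_eq with h1 | h1 <;> rcases ht.lt_or_eq with h2 | h2
  · exact (ha.smul h1).add (hb.smul h2)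
  · rw [← h2]; simpa using ha.smul h1
  · rw [← h1]; simpa using hb.smul h2
  · linarith

theorem chain_step {j : ℕ} {u : ℕ → ℂ} (h : Chain (j + 1) u) (δ : ℂ)
    (hl : ∀ i < j + 1, LexPos ((u (j + 1) - u i) / δ)) :
    ∀ i < j, LexPos ((u j - u i) / (u (j + 1) - u j)) := by
  obtain ⟨i0, hi0, hfirst⟩ := exists_first (j + 1) (by omega) (fun i => u (j + 1) - u i) δ hl
  set e := u (j + 1) - u i0 with he
  have he0 : e ≠ 0 := by
    intro h0
    have := (hl i0 hi0).ne
    rw [← he, h0] at this; simp at this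
  have hfirst' : ∀ i < j + 1, i ≠ i0 → LexPos ((u (j + 1) - u i) / e - 1) := by
    intro i hi hne
    rcases hfirst i hi with h1 | h1
    · exact h1
    · exfalso
      have : u i = u i0 := by
        rw [he] at h1
        exact sub_right_injective h1
      rcases lt_or_gt_of_ne hne with h2 | h2
      · exact h.inj h2 hi0 this.symm
      · exact h.inj h2 hi this
  by_cases hij : i0 = j
  · subst hij
    intro i hi
    have := hfirst' i (by omega) (by omega)
    have e1 : (u i0 - u i) / e = (u (i0 + 1) - u i) / e - 1 := by
      field_simp; rw [he]; ring
    rw [e1]; exact this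
  exfalso
  have hi0j : i0 < j := by omega
  have hjf := hfirst' j (by omega) (Ne.symm hij)
  -- the last vertex is strictly on the positive side
  have him : 0 < ((u (j + 1) - u j) / e).im := by
    rcases hjf with h1 | ⟨h1, h2⟩
    · simpa using h1
    · exfalso
      simp only [sub_im, one_im, sub_zero, sub_re, one_re] at h1 h2
      set t := ((u (j + 1) - u j) / e).re with ht
      have hzt : (u (j + 1) - u j) / e = (t : ℂ) := by
        apply Complex.ext
        · simp [ht]
        · simp [h1]
      have ht1 : 1 < t := by linarith
      rw [div_eq_iff he0] at hzt
      rcases Nat.lt_or_ge j (i0 + 2) with h3 | h3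
      · have : j = i0 + 1 := by omega
        subst this
        have hsp := h.nospike i0 (by omega)
        have e2 : u (i0 + 1) - u i0 = ((1 - t : ℝ) : ℂ) * e := by
          push_cast
          linear_combination (-1 : ℂ) * hzt + (-1 : ℂ) * he
        rw [show i0 + 2 = i0 + 1 + 1 by ring, hzt, e2, mul_div_mul_right _ _ he0, ← ofReal_div,
          ofReal_mem_slitPlane] at hsp
        have : t / (1 - t) < 0 := div_neg_of_pos_of_neg (by linarith) (by linarith)
        linarith
      · refine Set.disjoint_left.1 (h.nonadj i0 j h3 le_rfl) (left_mem_segment ℝ _ _) ?_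
        refine ⟨1 / t, 1 - 1 / t, by positivity, ?_, by ring, ?_⟩
        · rw [sub_nonneg, div_le_one (by linarith)]; exact ht1.le
        · have htc : (t : ℂ) ≠ 0 := by exact_mod_cast (by linarith : t ≠ 0)
          simp only [real_smul]
          push_cast
          field_simp
          linear_combination (-1 : ℂ) * hzt + (-t : ℂ) * he
  -- the closed sub-polygon
  obtain ⟨N, hN⟩ : ∃ N, N = j - i0 + 2 := ⟨_, rfl⟩
  have hlast : i0 + (N - 1) = j + 1 := by omega
  have hP : Poly N (fun i => (fun l => u (i0 + l)) (i % N)) := by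
    have hN3 : 3 ≤ N := by omega
    refine Poly.mk' (w := fun l => u (i0 + l)) hN3 ?_ ?_ ?_ ?_ ?_
    · intro i hi
      exact h.nospike (i0 + i) (by omega)
    · skip
      rw [hlast, show i0 + (N - 2) = j by omega, add_zero, ← neg_sub (u (j + 1)) (u i0), ← he]
      apply slit_inv
      rw [mem_slitPlane_iff]; right
      rw [div_neg, neg_im]
      linarith
    · skip
      rw [hlast, add_zero, ← neg_sub (u (j + 1)) (u i0), ← he]
      have := hfirst' (i0 + 1) (by omega) (by omega)
      have e1 : (u (i0 + 1) - u i0) / -e = (u (j + 1) - u (i0 + 1)) / e - 1 := by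
        field_simp; rw [he]; ring
      rw [e1, mem_slitPlane_iff]
      rcases this with h1 | h1
      · right; exact h1.ne'
      · left; exact h1.2
    · intro a b h1 h2
      exact h.nonadj (i0 + a) (i0 + b) (by omega) (by omega)
    · intro a h1 h2
      rw [hlast, add_zero, Set.disjoint_left]
      rintro p ⟨s, t, hs, ht, hst, rfl⟩ ⟨s', t', hs', ht', hst', hp⟩
      have k1 := lexpos_seg (hfirst' (i0 + a) (by omega) (by omega))
        (hfirst' (i0 + (a + 1)) (by omega) (by omega)) hs ht hst rfl
      have c1 : (s : ℂ) + t = 1 := by exact_mod_cast hst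
      have c2 : (s' : ℂ) + t' = 1 := by exact_mod_cast hst'
      have e1 : s * (u (j + 1) - u (i0 + a)) + t * (u (j + 1) - u (i0 + (a + 1))) =
          (t' : ℂ) * e := by
        simp only [real_smul] at hp
        linear_combination hp + (u (j + 1)) * c1 - (u (j + 1)) * c2 - (t' : ℂ) * he
      rw [e1, mul_div_assoc, div_self he0, mul_one, ← ofReal_one, ← ofReal_sub] at k1
      rcases k1 with k1 | k1
      · simp at k1
      · rw [ofReal_re] at k1
        linarith [k1.2]
  set w : ℕ → ℂ := fun i => (fun l => u (i0 + l)) (i % N) with hw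
  have hwlt : ∀ i < N, w i = u (i0 + i) := fun i hi => by
    simp only [hw]; rw [Nat.mod_eq_of_lt hi]
  have hcr : 0 < cr e (u (j + 1) - u j) := by
    rw [div_im_cr] at him
    have := normSq_pos.2 he0
    by_contra hc
    exact absurd him (not_lt.2 (div_nonpos_of_nonpos_of_nonneg (not_lt.1 hc) this.le))
  -- sign at the last vertex
  have hA : cv N w = 2 * Real.pi := by
    have hwlast : w (N - 1) = u (j + 1) := by rw [hwlt _ (by omega), hlast]
    have := hull_sign_shift hP (N - 1) (-e) (by
      intro i h1 h2
      have e1 : w (N - 1 + i) = u (i0 + (i - 1)) := by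
        rw [show N - 1 + i = (i - 1) + N by omega, hP.per, hwlt _ (by omega)]
      rw [hwlast, e1, ← neg_sub, neg_div_neg_eq]
      rcases hfirst (i0 + (i - 1)) (by omega) with h3 | h3
      · have : LexPos (1 : ℂ) := Or.inr (by simp)
        have := h3.add this
        rwa [sub_add_cancel] at this
      · rw [h3, div_self he0]
        exact Or.inr (by simp))
    rcases this with h1 | h1
    · exact h1.1
    · exfalso
      have h2 := h1.2
      have e1 : w (N - 1 + (N - 1)) = u j := by
        rw [show N - 1 + (N - 1) = (N - 2) + N by omega, hP.per, hwlt _ (by omega)]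
        congr 1; omega
      have e2 : w (N - 1 + 1) = u i0 := by
        rw [show N - 1 + 1 = 0 + N by omega, hP.per, hwlt _ (by omega), add_zero]
      rw [hwlast, e1, e2] at h2
      rw [he] at hcr
      unfold cr at *
      simp only [sub_re, sub_im] at *
      linarith
  -- sign at the far vertex
  obtain ⟨f, hf, hlex⟩ := exists_lexmin hP he0
  have hsg := hull_sign_shift hP f e hlex
  have hcv0 : 0 < Real.pi := Real.pi_pos
  have hturn : 0 < cr (w f - w (f + (N - 1))) (w (f + 1) - w f) := by
    rcases hsg with h1 | h1
    · exact h1.2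
    · rw [hA] at h1; linarith [h1.1]
  have hmin : ∀ i < N, ((w f) / e).im ≤ (w i / e).im := by
    intro i hi
    rcases lt_trichotomy i f with h1 | h1 | h1
    · have := hlex (i + N - f) (by omega) (by omega)
      rw [show f + (i + N - f) = i + N by omega, hP.per, sub_div] at this
      rcases this with h2 | h2
      · rw [sub_im] at h2; linarith
      · rw [sub_im] at h2; linarith [h2.1]
    · rw [h1]
    · have := hlex (i - f) (by omega) (by omega)
      rw [show f + (i - f) = i by omega, sub_div] at this
      rcases this with h2 | h2
      · rw [sub_im] at h2; linarith
      · rw [sub_im] at h2; linarith [h2.1]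
  have hj := hmin (N - 2) (by omega)
  rw [hwlt (N - 2) (by omega), show i0 + (N - 2) = j by omega] at hj
  have him2 := him
  rw [sub_div, sub_im] at him2
  have hf1 : f ≠ N - 1 := by
    rintro rfl
    rw [hwlt (N - 1) (by omega), hlast] at hj
    linarith
  have hf0 : f ≠ 0 := by
    rintro rfl
    rw [hwlt 0 (by omega), add_zero] at hj
    have : (u (j + 1) / e - u i0 / e).im = 0 := by
      rw [← sub_div, ← he, div_self he0]; simp
    rw [sub_im] at this
    linarith
  have e1 : w (f + (N - 1)) = u (i0 + (f - 1)) := by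
    rw [show f + (N - 1) = (f - 1) + N by omega, hP.per, hwlt _ (by omega)]
  rw [e1, hwlt f hf, hwlt (f + 1) (by omega)] at hturn
  have := h.turn (i0 + (f - 1)) (by omega)
  rw [show i0 + (f - 1) + 1 = i0 + f by omega, show i0 + (f - 1) + 2 = i0 + (f + 1) by omega] at this
  linarith

theorem chain_lex {k : ℕ} {u : ℕ → ℂ} (h : Chain k u) (δ : ℂ)
    (hl : ∀ i < k, LexPos ((u k - u i) / δ)) :
    ∀ j < k, ∀ i < j, LexPos ((u j - u i) / (u (j + 1) - u j)) := by
  induction k generalizing δ with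
  | zero => intro j hj; omega
  | succ k ih =>
    have hs := chain_step h δ hl
    intro j hj
    rcases Nat.lt_or_ge j k with h1 | h1
    · exact ih (h.initial (by omega)) (u (k + 1) - u k) hs j h1
    · have : j = k := by omega
      subst this
      exact hs

theorem cr_nonneg_of_lex {a b : ℂ} (h : LexPos (b / a)) : 0 ≤ cr a b := by
  have h1 : 0 ≤ (b / a).im := by
    rcases h with h | h
    · exact h.le
    · exact h.1.ge
  rw [div_im_cr] at h1
  by_contra hc
  push Not at hc
  have ha : a ≠ 0 := by rintro rfl; simp [cr] at hc
  exact absurd h1 (not_le.2 (div_neg_of_neg_of_pos hc (normSq_pos.2 ha)))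

theorem seg_conj {a b c d : ℂ} (h : Disjoint (segment ℝ a b) (segment ℝ c d)) :
    Disjoint (segment ℝ ((starRingEnd ℂ) d) ((starRingEnd ℂ) c))
      (segment ℝ ((starRingEnd ℂ) b) ((starRingEnd ℂ) a)) := by
  have key : ∀ {x y p : ℂ}, p ∈ segment ℝ ((starRingEnd ℂ) y) ((starRingEnd ℂ) x) →
      (starRingEnd ℂ) p ∈ segment ℝ x y := by
    rintro x y p ⟨s, t, hs, ht, hst, rfl⟩
    refine ⟨t, s, ht, hs, by linarith, ?_⟩
    simp
    ring
  rw [Set.disjoint_left] at *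
  intro p h1 h2
  exact h (key h2) (key h1)

theorem Chain.rev {k : ℕ} {u : ℕ → ℂ} (h : Chain k u) :
    Chain k (fun i => (starRingEnd ℂ) (u (k - i))) where
  ne i hi he := by
    have := h.ne (k - (i + 1)) (by omega)
    rw [show k - (i + 1) + 1 = k - i by omega] at this
    exact this ((starRingEnd ℂ).injective he).symm
  turn i hi := by
    have := h.turn (k - (i + 2)) (by omega)
    rw [show k - (i + 2) + 1 = k - (i + 1) by omega, show k - (i + 2) + 2 = k - i by omega] at this
    unfold cr at *
    simp only [sub_re, sub_im, conj_re, conj_im] at *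
    linarith
  nospike i hi := by
    have := h.nospike (k - (i + 2)) (by omega)
    rw [show k - (i + 2) + 1 = k - (i + 1) by omega, show k - (i + 2) + 2 = k - i by omega] at this
    have := slit_inv this
    rw [← map_sub, ← map_sub, ← map_div₀, ← neg_sub (u (k - (i + 1))), ← neg_sub (u (k - i)),
      neg_div_neg_eq]
    rw [mem_slitPlane_iff] at *
    rw [conj_re, conj_im]; simpa only [ne_eq, neg_eq_zero] using this
  nonadj i j h1 h2 := by
    have := h.nonadj (k - (j + 1)) (k - (i + 1)) (by omega) (by omega)
    rw [show k - (j + 1) + 1 = k - j by omega, show k - (i + 1) + 1 = k - i by omega] at this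
    exact seg_conj this

/-- main conclusion: every chain vertex is weakly to the right of every chain edge -/
theorem chain_right {k : ℕ} {u : ℕ → ℂ} (h : Chain k u) (δ δ' : ℂ)
    (hl : ∀ i < k, LexPos ((u k - u i) / δ))
    (hl' : ∀ i, 0 < i → i ≤ k → LexPos (((starRingEnd ℂ) (u 0 - u i)) / δ')) :
    ∀ j < k, ∀ i ≤ k, cr (u (j + 1) - u j) (u i - u j) ≤ 0 := by
  intro j hj i hi
  rcases lt_trichotomy i j with h1 | h1 | h1
  · have := cr_nonneg_of_lex (chain_lex h δ hl j hj i h1)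
    unfold cr at *
    simp only [sub_re, sub_im] at *
    linarith
  · rw [h1]; simp [cr]
  · rcases Nat.lt_or_ge (j + 1) i with h2 | h2
    · have := chain_lex h.rev δ' (by
        intro i hi
        have := hl' (k - i) (by omega) (by omega)
        rw [Nat.sub_self, ← map_sub]
        exact this) (k - (j + 1)) (by omega) (k - i) (by omega)
      rw [show k - (k - (j + 1)) = j + 1 by omega, show k - (k - i) = i by omega,
        show k - (k - (j + 1) + 1) = j by omega] at this
      have := cr_nonneg_of_lex this
      unfold cr at *
      simp only [sub_re, sub_im, conj_re, conj_im] at *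
      linarith
    · have : i = j + 1 := by omega
      subst this
      unfold cr
      linarith

end FP


namespace FP
open Complex

/-- winding function -/
noncomputable def W (n : ℕ) (v : ℕ → ℂ) (p : ℂ) : ℝ :=
  ∑ i ∈ Finset.range n, arg ((v (i + 1) - p) / (v i - p))

/-- boundary -/
def Bd (n : ℕ) (v : ℕ → ℂ) : Set ℂ := ⋃ i ∈ Finset.range n, segment ℝ (v i) (v (i + 1))

theorem mem_Bd {n : ℕ} {v : ℕ → ℂ} {p : ℂ} :
    p ∈ Bd n v ↔ ∃ i < n, p ∈ segment ℝ (v i) (v (i + 1)) := by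
  simp [Bd]

theorem seg_compact (a b : ℂ) : IsCompact (segment ℝ a b) := by
  rw [segment_eq_image']
  exact isCompact_Icc.image (by fun_prop)

theorem Bd_compact (n : ℕ) (v : ℕ → ℂ) : IsCompact (Bd n v) :=
  (Finset.range n).isCompact_biUnion fun _ _ => seg_compact _ _

theorem slit_num_ne {a b : ℂ} (h : a / b ∈ slitPlane) : a ≠ 0 := by
  rintro rfl; simp at h

theorem slit_den_ne {a b : ℂ} (h : a / b ∈ slitPlane) : b ≠ 0 := by
  rintro rfl; simp at h

theorem W_angle {n : ℕ} {v : ℕ → ℂ} (hv : v n = v 0) {p : ℂ} (hp : ∀ i ≤ n, v i - p ≠ 0) :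
    (W n v p : Real.Angle) = 0 := by
  unfold W
  rw [angle_telescope' (fun i => v i - p) n hp, hv, sub_self]

theorem ne_of_not_Bd {n : ℕ} {v : ℕ → ℂ} (hn : 0 < n) {p : ℂ} (hp : p ∉ Bd n v) :
    ∀ i ≤ n, v i - p ≠ 0 := by
  intro i hi h0
  have : v i = p := sub_eq_zero.1 h0
  apply hp
  rw [mem_Bd]
  rcases hi.lt_or_eq with h | h
  · exact ⟨i, h, by rw [← this]; exact left_mem_segment ℝ _ _⟩
  · refine ⟨n - 1, by omega, ?_⟩
    rw [show n - 1 + 1 = n by omega, ← h, this]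
    exact right_mem_segment ℝ _ _

theorem slit_of_not_Bd {n : ℕ} {v : ℕ → ℂ} {p : ℂ} (hp : p ∉ Bd n v) {i : ℕ} (hi : i < n) :
    (v (i + 1) - p) / (v i - p) ∈ slitPlane := by
  apply slit_of_not_mem_segment
  intro h
  exact hp (mem_Bd.2 ⟨i, hi, h⟩)

theorem contAt_arg_ratio {a b p : ℂ} (h : (b - p) / (a - p) ∈ slitPlane) :
    ContinuousAt (fun p => arg ((b - p) / (a - p))) p :=
  ContinuousAt.comp (f := fun p => (b - p) / (a - p)) (continuousAt_arg h)
    (ContinuousAt.div (by fun_prop) (by fun_prop) (slit_den_ne h))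

theorem W_contAt {n : ℕ} {v : ℕ → ℂ} {p : ℂ} (hp : p ∉ Bd n v) : ContinuousAt (W n v) p := by
  unfold W
  refine tendsto_finsetSum _ fun i hi => ?_
  exact contAt_arg_ratio (slit_of_not_Bd hp (Finset.mem_range.1 hi))

theorem W_const {n : ℕ} {v : ℕ → ℂ} (hn : 0 < n) (hv : v n = v 0) {S : Set ℂ}
    (hS : IsPreconnected S) (hB : ∀ p ∈ S, p ∉ Bd n v) {p q : ℂ} (hp : p ∈ S) (hq : q ∈ S) :
    W n v p = W n v q :=
  const_of_angle hS (fun x hx => (W_contAt (hB x hx)).continuousWithinAt)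
    (fun x hx => W_angle hv (ne_of_not_Bd hn (hB x hx))) hp hq

theorem W_lex {n : ℕ} {v : ℕ → ℂ} (hv : v n = v 0) {p ω : ℂ}
    (h : ∀ i ≤ n, LexPos ((v i - p) / ω)) : W n v p = 0 := by
  unfold W
  have : ∀ i ∈ Finset.range n, arg ((v (i + 1) - p) / (v i - p)) =
      arg ((v (i + 1) - p) / ω) - arg ((v i - p) / ω) := by
    intro i hi
    have hi := Finset.mem_range.1 hi
    rw [← arg_div_lex (h i hi.le) (h (i + 1) hi)]
    congr 1
    have hω : ω ≠ 0 := by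
      rintro rfl
      exact (h i hi.le).ne (by simp)
    field_simp
  rw [Finset.sum_congr rfl this, Finset.sum_range_sub (fun i => arg ((v i - p) / ω)), hv, sub_self]

theorem W_far {n : ℕ} {v : ℕ → ℂ} (hv : v n = v 0) : ∃ R : ℝ, ∀ p : ℂ, R < ‖p‖ → W n v p = 0 := by
  refine ⟨∑ i ∈ Finset.range (n + 1), ‖v i‖, fun p hp => ?_⟩
  have hlt : ∀ i ≤ n, ‖v i‖ < ‖p‖ := fun i hi =>
    lt_of_le_of_lt (Finset.single_le_sum (f := fun i => ‖v i‖) (fun _ _ => norm_nonneg _)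
      (Finset.mem_range.2 (by omega))) hp
  have hp0 : p ≠ 0 := by
    intro h
    have := hlt 0 (by omega)
    rw [h, norm_zero] at this
    exact absurd this (not_lt.2 (norm_nonneg _))
  apply W_lex hv (ω := I * p)
  intro i hi
  left
  have e : (v i - p) / (I * p) = I - I * (v i / p) := by
    field_simp; rw [I_sq]; ring
  rw [e]
  have h1 : (v i / p).re < 1 := by
    refine lt_of_le_of_lt (re_le_norm _) ?_
    rw [norm_div, div_lt_one (norm_pos_iff.2 hp0)]
    exact hlt i hi
  simp; exact h1

theorem W_shift1 {n : ℕ} {v : ℕ → ℂ} (per : ∀ i, v (i + n) = v i) (p : ℂ) :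
    W n (fun i => v (i + 1)) p = W n v p := by
  unfold W
  have h0 : v n = v 0 := by simpa using per 0
  have h1 : v (n + 1) = v 1 := by rw [add_comm]; exact per 1
  have := Finset.sum_range_succ (fun i => arg ((v (i + 1) - p) / (v i - p))) n
  rw [Finset.sum_range_succ', h0, h1] at this
  linarith

theorem W_shift {n : ℕ} {v : ℕ → ℂ} (per : ∀ i, v (i + n) = v i) (p : ℂ) (j : ℕ) :
    W n (fun i => v (j + i)) p = W n v p := by
  induction j with
  | zero => simp
  | succ j ih =>
    rw [← ih, ← W_shift1 (v := fun i => v (j + i)) (fun i => by rw [← add_assoc]; exact per _)]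
    congr 1
    funext i
    congr 1
    ring

/-- other edges seen from an interior point of edge 0 -/
theorem slit_edge {n : ℕ} {v : ℕ → ℂ} (h : Poly n v) {s : ℝ} (h0 : 0 < s) (h1 : s < 1) {p : ℂ}
    (hp : p = v 0 + s * (v 1 - v 0)) {i : ℕ} (hi : i < n - 1) :
    (v (i + 2) - p) / (v (i + 1) - p) ∈ slitPlane := by
  have hn := h.hn
  have hd : v 1 - v 0 ≠ 0 := h.edge_ne 0
  have hs : (s : ℂ) ≠ 0 := by exact_mod_cast h0.ne'
  have hs1 : ((1 - s : ℝ) : ℂ) ≠ 0 := by exact_mod_cast (by linarith : (1 - s) ≠ 0)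
  rcases Nat.eq_zero_or_pos i with rfl | hi0
  · have := h.nospike 0
    simp only [zero_add] at this ⊢
    have e : (v 2 - p) / (v 1 - p) = 1 + ((1 / (1 - s) : ℝ) : ℂ) * ((v 2 - v 1) / (v 1 - v 0)) := by
      have e1 : v 1 - p = ((1 - s : ℝ) : ℂ) * (v 1 - v 0) := by rw [hp]; push_cast; ring
      have e2 : v 2 - p = (v 2 - v 1) + (v 1 - p) := by ring
      rw [e2, e1]; push_cast at hs1 ⊢; field_simp; ring
    rw [e]
    have hpos : 0 < 1 / (1 - s) := by apply one_div_pos.2; linarith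
    rw [mem_slitPlane_iff] at this ⊢
    rcases this with h2 | h2
    · left
      rw [add_re, re_ofReal_mul, one_re]
      positivity
    · right
      rw [add_im, im_ofReal_mul, one_im, zero_add]
      exact mul_ne_zero hpos.ne' h2
  rcases (by omega : i + 2 < n ∨ i + 2 = n) with hi1 | hi1
  · apply slit_of_not_mem_segment
    intro hm
    have := h.nonadj 0 (i + 1) (by omega) (by omega)
    rw [zero_add, zero_add] at this
    refine Set.disjoint_left.1 this ?_ hm
    rw [segment_eq_image']
    exact ⟨s, ⟨h0.le, h1.le⟩, by simp [hp]⟩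
  · have hper0 : v n = v 0 := by simpa using h.per 0
    have hper1 : v (n + 1) = v 1 := by rw [add_comm]; exact h.per 1
    have := slit_inv (h.nospike (i + 1))
    rw [show i + 1 + 1 = n by omega, show i + 1 + 2 = n + 1 by omega, hper0, hper1] at this
    apply slit_inv
    rw [hi1, hper0]
    have e : (v (i + 1) - p) / (v 0 - p) =
        1 + ((1 / s : ℝ) : ℂ) * ((v 0 - v (i + 1)) / (v 1 - v 0)) := by
      have e1 : v 0 - p = -((s : ℂ) * (v 1 - v 0)) := by rw [hp]; ring
      have e2 : v (i + 1) - p = (v 0 - p) - (v 0 - v (i + 1)) := by ring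
      rw [e2, e1]; push_cast; field_simp; ring
    rw [e]
    have hpos : 0 < 1 / s := by apply one_div_pos.2; linarith
    rw [mem_slitPlane_iff] at this ⊢
    rcases this with h2 | h2
    · left
      rw [add_re, re_ofReal_mul, one_re]
      positivity
    · right
      rw [add_im, im_ofReal_mul, one_im, zero_add]
      exact mul_ne_zero hpos.ne' h2

theorem arg_neg_cases {z : ℂ} (h : z.im ≠ 0) :
    arg (-z) = arg z + Real.pi ∨ arg (-z) = arg z - Real.pi := by
  rcases lt_or_gt_of_ne h with h | h
  · left; rw [arg_neg_eq_arg_add_pi_of_im_neg h]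
  · right; rw [arg_neg_eq_arg_sub_pi_of_im_pos h]

/-- crossing an edge -/
theorem W_cross {n : ℕ} {v : ℕ → ℂ} (h : Poly n v) {s : ℝ} (h0 : 0 < s) (h1 : s < 1) {q : ℂ}
    (hq : q = v 0 + s * (v 1 - v 0)) {T : ℝ} (hT : 0 < T) (him : (v 1 - v 0).im ≠ 0)
    (hB : ∀ t : ℝ, 0 < t → t ≤ T → q - t ∉ Bd n v) :
    W n v (q - T) = cv n v ∨ W n v (q - T) = cv n v - 2 * Real.pi := by
  obtain ⟨m, rfl⟩ : ∃ m, n = m + 1 := ⟨n - 1, by have := h.hn; omega⟩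
  have hd : v 1 - v 0 ≠ 0 := h.edge_ne 0
  have hvn : v (m + 1) = v 0 := by simpa using h.per 0
  have hs : (s : ℂ) ≠ 0 := by exact_mod_cast h0.ne'
  have hcr : ∀ t : ℝ, cr (v 0 - (q - t)) (v 1 - (q - t)) = t * (v 1 - v 0).im := by
    intro t
    rw [hq]; simp [cr]; ring
  have hown : ∀ t : ℝ, 0 < t → ((v 1 - (q - t)) / (v 0 - (q - t))).im ≠ 0 := by
    intro t ht
    rw [div_im_cr, hcr]
    have : v 0 - (q - t) ≠ 0 := by
      intro h0
      have := hcr t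
      rw [h0] at this
      simp only [cr, zero_re, zero_im, zero_mul, sub_zero] at this
      exact mul_ne_zero ht.ne' him this.symm
    exact div_ne_zero (mul_ne_zero ht.ne' him) (normSq_pos.2 this).ne'
  have hown0 : (v 1 - q) / (v 0 - q) = ((-((1 - s) / s) : ℝ) : ℂ) := by
    have e1 : v 0 - q = -((s : ℂ) * (v 1 - v 0)) := by rw [hq]; ring
    have e2 : v 1 - q = (1 - s : ℂ) * (v 1 - v 0) := by rw [hq]; ring
    rw [e1, e2]; push_cast; field_simp
  have hpos : 0 < (1 - s) / s := div_pos (by linarith) h0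
  have hownslit : ∀ t ∈ Set.Icc (0:ℝ) T, -((v 1 - (q - t)) / (v 0 - (q - t))) ∈ slitPlane := by
    intro t ht
    rcases ht.1.lt_or_eq with h2 | h2
    · rw [mem_slitPlane_iff]; right
      rw [neg_im]; exact neg_ne_zero.2 (hown t h2)
    · rw [← h2, ofReal_zero, sub_zero, hown0, ← ofReal_neg, ofReal_mem_slitPlane]
      linarith
  have hoth : ∀ i < m, ∀ t ∈ Set.Icc (0:ℝ) T,
      (v (i + 2) - (q - t)) / (v (i + 1) - (q - t)) ∈ slitPlane := by
    intro i hi t ht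
    rcases ht.1.lt_or_eq with h2 | h2
    · exact slit_of_not_Bd (hB t h2 ht.2) (i := i + 1) (by omega)
    · rw [← h2, ofReal_zero, sub_zero]
      exact slit_edge h h0 h1 hq (by omega)
  set G : ℝ → ℝ := fun t => (∑ i ∈ Finset.range m, arg ((v (i + 2) - (q - t)) / (v (i + 1) - (q - t))))
    + arg (-((v 1 - (q - t)) / (v 0 - (q - t)))) - Real.pi with hG
  have hconst : G 0 = G T := by
    refine const_of_angle (isPreconnected_Icc (a := (0:ℝ)) (b := T)) ?_ ?_
      ⟨le_rfl, hT.le⟩ ⟨hT.le, le_rfl⟩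
    · intro t ht
      apply ContinuousAt.continuousWithinAt
      refine (ContinuousAt.add ?_ ?_).sub continuousAt_const
      · refine tendsto_finsetSum _ fun i hi => ?_
        have := hoth i (Finset.mem_range.1 hi) t ht
        exact ContinuousAt.comp (f := fun t : ℝ => (v (i + 2) - (q - t)) / (v (i + 1) - (q - t)))
          (continuousAt_arg this)
          (ContinuousAt.div (by fun_prop) (by fun_prop) (slit_den_ne this))
      · have := hownslit t ht
        refine ContinuousAt.comp (f := fun t : ℝ => -((v 1 - (q - t)) / (v 0 - (q - t))))
          (continuousAt_arg this) (ContinuousAt.neg ?_)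
        refine ContinuousAt.div (by fun_prop) (by fun_prop) ?_
        rw [← neg_div] at this
        exact slit_den_ne this
    · intro t ht
      have o := hownslit t ht
      rw [← neg_div] at o
      have n0 := slit_den_ne o
      have n1 := neg_ne_zero.1 (slit_num_ne o)
      have hne : ∀ i ≤ m, v (i + 1) - (q - t) ≠ 0 := by
        intro i hi
        rcases hi.lt_or_eq with h2 | h2
        · exact slit_den_ne (hoth i h2 t ht)
        · rw [h2, hvn]; exact n0
      have tel := angle_telescope' (fun i => v (i + 1) - (q - t)) m hne
      have tel' : ((∑ i ∈ Finset.range m, arg ((v (i + 2) - (q - t)) / (v (i + 1) - (q - t))) : ℝ) : Real.Angle)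
        = arg (v 0 - (q - t)) - arg (v 1 - (q - t)) := by
        rw [← hvn]; exact tel
      simp only [hG]
      rw [Real.Angle.coe_sub, Real.Angle.coe_add, tel', arg_neg_coe_angle (div_ne_zero n1 n0),
        arg_div_coe_angle n1 n0]
      abel
  have hcv := cv_edge h h0 h1 hq
  have e0 : G 0 = cv (m + 1) v - 2 * Real.pi := by
    simp only [hG, ofReal_zero, sub_zero]
    rw [hcv, hown0, ← ofReal_neg, arg_ofReal_of_nonneg (by linarith), Nat.add_sub_cancel]
    ring
  have eT : W (m + 1) v (q - T) = G T + Real.pi + (arg ((v 1 - (q - T)) / (v 0 - (q - T))) -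
      arg (-((v 1 - (q - T)) / (v 0 - (q - T))))) := by
    simp only [hG]
    unfold W
    rw [Finset.sum_range_succ']
    simp only [zero_add, add_assoc, one_add_one_eq_two]
    ring
  rw [eT, ← hconst, e0]
  rcases arg_neg_cases (hown T hT) with h2 | h2
  · right; rw [h2]; ring
  · left; rw [h2]; ring

theorem W_values {n : ℕ} {v : ℕ → ℂ} (h : Poly n v) {p : ℂ} (hp : p ∉ Bd n v)
    (him : ∀ i, p.im ≠ (v i).im) :
    W n v p = 0 ∨ W n v p = cv n v ∨ W n v p = cv n v - 2 * Real.pi := by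
  have hn := h.hn
  have hper0 : v n = v 0 := by simpa using h.per 0
  set S : Set ℝ := {t | 0 ≤ t ∧ p + t ∈ Bd n v} with hS
  have hSc : IsClosed S := by
    have : S = Set.Ici 0 ∩ (fun t : ℝ => p + t) ⁻¹' Bd n v := rfl
    rw [this]
    exact isClosed_Ici.inter ((Bd_compact n v).isClosed.preimage (by fun_prop))
  by_cases hne : S.Nonempty
  swap
  · left
    rw [Set.not_nonempty_iff_eq_empty] at hne
    obtain ⟨R, hR⟩ := W_far hper0
    have hpre : IsPreconnected ((fun t : ℝ => p + t) '' Set.Ici 0) :=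
      isPreconnected_Ici.image _ (by fun_prop)
    have hB : ∀ x ∈ ((fun t : ℝ => p + t) '' Set.Ici 0), x ∉ Bd n v := by
      rintro x ⟨t, ht, rfl⟩ hx
      have : t ∈ S := ⟨ht, hx⟩
      rw [hne] at this; exact this
    have hbig : R < ‖p + ((‖p‖ + |R| + 1 : ℝ) : ℂ)‖ := by
      have h1 : ‖((‖p‖ + |R| + 1 : ℝ) : ℂ)‖ = ‖p‖ + |R| + 1 := by
        rw [norm_real, Real.norm_of_nonneg (by positivity)]
      have h2 := norm_sub_le (p + ((‖p‖ + |R| + 1 : ℝ) : ℂ)) p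
      rw [add_sub_cancel_left, h1] at h2
      have := le_abs_self R
      linarith
    rw [← hR _ hbig]
    exact W_const (by omega) hper0 hpre hB ⟨0, by simp, by simp⟩
      ⟨‖p‖ + |R| + 1, by simp only [Set.mem_Ici]; positivity, rfl⟩
  right
  have hbdd : BddBelow S := ⟨0, fun t ht => ht.1⟩
  have hT := hSc.csInf_mem hne hbdd
  set T := sInf S with hTdef
  have hT0 : 0 < T := by
    rcases hT.1.lt_or_eq with h1 | h1
    · exact h1
    · exfalso
      apply hp
      have := hT.2
      rwa [← h1, ofReal_zero, add_zero] at this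
  obtain ⟨j, hj, hq⟩ := mem_Bd.1 hT.2
  rw [segment_eq_image'] at hq
  obtain ⟨s, ⟨hs0, hs1⟩, hsq⟩ := hq
  simp only [real_smul] at hsq
  have himq : (v j + s * (v (j + 1) - v j)).im = p.im := by
    rw [hsq]; simp
  have a0 : 0 < s := by
    rcases hs0.lt_or_eq with h1 | h1
    · exact h1
    · exfalso; apply him j; rw [← himq, ← h1]; simp
  have a1 : s < 1 := by
    rcases hs1.lt_or_eq with h1 | h1
    · exact h1
    · exfalso; apply him (j + 1); rw [← himq, h1]; simp
  have a2 : (v (j + 1) - v (j + 0)).im ≠ 0 := by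
    intro h1
    apply him j
    rw [← himq, add_im, im_ofReal_mul]
    rw [add_zero] at h1
    rw [h1]; simp
  have hBd : ∀ x, x ∉ Bd n v → x ∉ Bd n (fun i => v (j + i)) := by
    intro x hx hx'
    obtain ⟨i, hi, hm⟩ := mem_Bd.1 hx'
    apply hx
    rw [mem_Bd]
    rcases Nat.lt_or_ge (j + i) n with h1 | h1
    · exact ⟨j + i, h1, hm⟩
    · refine ⟨j + i - n, by omega, ?_⟩
      have e1 := h.per (j + i - n)
      have e2 := h.per (j + i - n + 1)
      rw [show j + i - n + n = j + i by omega] at e1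
      rw [show j + i - n + 1 + n = j + (i + 1) by omega] at e2
      rw [← e1, ← e2]; exact hm
  have := W_cross (h.shift j) a0 a1 (q := p + T) (by rw [← hsq]; rfl) hT0 a2 (by
    intro t ht htT
    apply hBd
    intro hm
    rw [show p + (T : ℂ) - t = p + ((T - t : ℝ) : ℂ) by push_cast; ring] at hm
    have := csInf_le hbdd (show T - t ∈ S from ⟨by linarith, hm⟩)
    rw [← hTdef] at this
    linarith)
  rw [cv_shift h j, W_shift h.per, add_sub_cancel_right] at this
  exact this

end FP


namespace FP
open Complex MeasureTheory

/-- open triangle with vertices `0, a, b`, positively oriented -/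
def Tri (a b : ℂ) : Set ℂ := {p | 0 < cr (a - p) (b - p) ∧ 0 < cr p b ∧ 0 < cr a p}

/-- standard open triangle -/
def Std : Set ℂ := {p | 0 < p.re ∧ 0 < p.im ∧ p.re + p.im < 1}

theorem cr_cont {f g : ℂ → ℂ} (hf : Continuous f) (hg : Continuous g) :
    Continuous fun p => cr (f p) (g p) := by
  unfold cr
  fun_prop

theorem Std_open : IsOpen Std := by
  have h1 : IsOpen {p : ℂ | 0 < p.re} := isOpen_lt (by fun_prop) (by fun_prop)
  have h2 : IsOpen {p : ℂ | 0 < p.im} := isOpen_lt (by fun_prop) (by fun_prop)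
  have h3 : IsOpen {p : ℂ | p.re + p.im < 1} := isOpen_lt (by fun_prop) (by fun_prop)
  exact h1.inter (h2.inter h3)

theorem Tri_open (a b : ℂ) : IsOpen (Tri a b) := by
  have h1 : IsOpen {p : ℂ | 0 < cr (a - p) (b - p)} :=
    isOpen_lt (by fun_prop) (cr_cont (by fun_prop) (by fun_prop))
  have h2 : IsOpen {p : ℂ | 0 < cr p b} := isOpen_lt (by fun_prop) (cr_cont (by fun_prop) (by fun_prop))
  have h3 : IsOpen {p : ℂ | 0 < cr a p} := isOpen_lt (by fun_prop) (cr_cont (by fun_prop) (by fun_prop))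
  exact h1.inter (h2.inter h3)

theorem Std_pos : 0 < volume Std := by
  refine Std_open.measure_pos volume ⟨⟨1/4, 1/4⟩, ?_⟩
  refine ⟨?_, ?_, ?_⟩ <;> norm_num

theorem Std_fin : volume Std < ⊤ := by
  refine (Metric.isBounded_closedBall (x := (0:ℂ)) (r := 2)).subset ?_ |>.measure_lt_top
  rintro p ⟨h1, h2, h3⟩
  rw [mem_closedBall_zero_iff]
  refine (norm_le_abs_re_add_abs_im p).trans ?_
  rw [abs_of_pos h1, abs_of_pos h2]; linarith

/-- the linear map sending `1, I` to `a, b` -/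
noncomputable def lin (a b : ℂ) : ℂ →ₗ[ℝ] ℂ :=
  reLm.smulRight a + imLm.smulRight b

theorem lin_apply (a b z : ℂ) : lin a b z = z.re * a + z.im * b := by
  simp [lin]

theorem lin_det (a b : ℂ) : LinearMap.det (lin a b) = cr a b := by
  rw [← LinearMap.det_toMatrix basisOneI, Matrix.det_fin_two]
  simp [LinearMap.toMatrix_apply, lin_apply, cr]
  ring

theorem Tri_image {a b : ℂ} (h : 0 < cr a b) : Tri a b = lin a b '' Std := by
  ext p
  constructor
  · rintro ⟨h1, h2, h3⟩
    refine ⟨⟨cr p b / cr a b, cr a p / cr a b⟩, ⟨by positivity, by positivity, ?_⟩, ?_⟩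
    · simp only
      rw [← add_div, div_lt_one h]
      have : cr (a - p) (b - p) = cr a b - (cr p b + cr a p) := by simp [cr]; ring
      linarith
    · rw [lin_apply]
      apply Complex.ext
      · simp only [add_re, re_ofReal_mul]
        field_simp
        simp [cr]; ring
      · simp only [add_im, im_ofReal_mul]
        field_simp
        simp [cr]; ring
  · rintro ⟨z, ⟨h1, h2, h3⟩, rfl⟩
    rw [lin_apply]
    refine ⟨?_, ?_, ?_⟩
    · have : cr (a - (z.re * a + z.im * b)) (b - (z.re * a + z.im * b)) =
        (1 - (z.re + z.im)) * cr a b := by simp [cr]; ring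
      rw [this]; apply mul_pos _ h; linarith
    · have : cr (z.re * a + z.im * b) b = z.re * cr a b := by simp [cr]; ring
      rw [this]; positivity
    · have : cr a (z.re * a + z.im * b) = z.im * cr a b := by simp [cr]; ring
      rw [this]; positivity

theorem Tri_vol (a b : ℂ) : volume (Tri a b) = ENNReal.ofReal (cr a b) * volume Std := by
  rcases lt_or_ge 0 (cr a b) with h | h
  · rw [Tri_image h, Measure.addHaar_image_linearMap, lin_det, abs_of_pos h]
  · have : Tri a b = ∅ := by
      ext p
      simp only [Set.mem_empty_iff_false, iff_false]
      rintro ⟨h1, h2, h3⟩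
      have : cr (a - p) (b - p) = cr a b - (cr p b + cr a p) := by simp [cr]; ring
      linarith
    rw [this, ENNReal.ofReal_of_nonpos h]; simp

theorem Tri_int (a b : ℂ) : Integrable ((Tri a b).indicator (fun _ => (1:ℝ))) volume ∧
    ∫ p, (Tri a b).indicator (fun _ => (1:ℝ)) p = max (cr a b) 0 * (volume Std).toReal := by
  have hm := (Tri_open a b).measurableSet
  constructor
  · rw [integrable_indicator_iff hm]
    refine integrableOn_const ?_
    rw [Tri_vol]
    exact ENNReal.mul_ne_top ENNReal.ofReal_ne_top Std_fin.ne
  · rw [integral_indicator_const _ hm, Measure.real, Tri_vol, ENNReal.toReal_mul, ENNReal.toReal_ofReal']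
    simp

theorem line_null (L : ℂ →ₗ[ℝ] ℝ) (c : ℝ) (w : ℂ) (hw : L w ≠ 0) : volume {z : ℂ | L z = c} = 0 := by
  let S : AffineSubspace ℝ ℂ :=
    { carrier := {z | L z = c}
      smul_vsub_vadd_mem' := by
        intro t p1 p2 p3 h1 h2 h3
        simp only [Set.mem_ofPred_eq] at *
        rw [vsub_eq_sub, vadd_eq_add, map_add, map_smul, map_sub, h1, h2, h3]
        simp }
  refine Measure.addHaar_affineSubspace volume S ?_
  intro h
  have h0 : (0:ℂ) ∈ S := by rw [h]; trivial
  have h1 : w ∈ S := by rw [h]; trivial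
  have h0' : L 0 = c := h0
  have h1' : L w = c := h1
  rw [map_zero] at h0'
  apply hw; rw [h1', ← h0']

theorem seg_null (a b : ℂ) : volume (segment ℝ a b) = 0 := by
  by_cases hab : b - a = 0
  · have : b = a := sub_eq_zero.1 hab
    rw [this, segment_same]; simp
  let L : ℂ →ₗ[ℝ] ℝ := (b - a).re • imLm - (b - a).im • reLm
  have hL : ∀ z, L z = cr (b - a) z := by
    intro z; simp [L, cr]
  refine measure_mono_null ?_ (line_null L (L a) (I * (b - a)) ?_)
  · rintro p ⟨s, t, hs, ht, hst, rfl⟩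
    have : s = 1 - t := by linarith
    simp only [Set.mem_ofPred_eq, hL, cr, this, real_smul]
    simp; ring
  · rw [hL]
    have : cr (b - a) (I * (b - a)) = normSq (b - a) := by simp [cr, normSq_apply]; ring
    rw [this]; exact (normSq_pos.2 hab).ne'

theorem horiz_null (c : ℝ) : volume {z : ℂ | z.im = c} = 0 :=
  line_null imLm c I (by simp)

theorem arg_pos_of_im {z : ℂ} (h : 0 < z.im) : 0 < arg z := by
  rcases (arg_nonneg_iff.2 h.le).lt_or_eq with h1 | h1
  · exact h1
  · exact absurd ((arg_eq_zero_iff.1 h1.symm).2) h.ne'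

theorem im_pos_of_arg {z : ℂ} (h : 0 < arg z) (h' : arg z < Real.pi) : 0 < z.im := by
  rcases (arg_nonneg_iff.1 h.le).lt_or_eq with h1 | h1
  · exact h1
  · rcases arg_lt_pi_iff.1 h' with h2 | h2
    · exact absurd (arg_eq_zero_iff.2 ⟨h2, h1.symm⟩) h.ne'
    · exact absurd h1.symm h2

theorem im_pos_iff_cr {a b : ℂ} (ha : a ≠ 0) : 0 < (b / a).im ↔ 0 < cr a b := by
  rw [div_im_cr, div_pos_iff_of_pos_right (normSq_pos.2 ha)]

theorem im_neg_iff_cr {a b : ℂ} (ha : a ≠ 0) : (b / a).im < 0 ↔ cr a b < 0 := by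
  rw [div_im_cr, div_lt_iff₀ (normSq_pos.2 ha), zero_mul]

theorem im_neg_of_arg {z : ℂ} (h : arg z < 0) : z.im < 0 := arg_neg_iff.1 h

open Classical in
theorem tri_arg {a b p : ℂ} (h1 : p ∉ segment ℝ a b) (h2 : p ∉ segment ℝ 0 a)
    (h3 : p ∉ segment ℝ b 0) :
    arg ((b - p) / (a - p)) + arg ((a - p) / (0 - p)) + arg ((0 - p) / (b - p)) =
      2 * Real.pi * ((Tri a b).indicator (fun _ => (1:ℝ)) p - (Tri b a).indicator (fun _ => (1:ℝ)) p) := by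
  have hpi := Real.pi_pos
  have s1 := slit_of_not_mem_segment h1
  have s2 := slit_of_not_mem_segment h2
  have s3 := slit_of_not_mem_segment h3
  have na := slit_den_ne s1
  have n0 := slit_den_ne s2
  have nb := slit_den_ne s3
  have l1 := (mem_slitPlane_iff_arg.1 s1).1.lt_of_le (arg_le_pi _)
  have l2 := (mem_slitPlane_iff_arg.1 s2).1.lt_of_le (arg_le_pi _)
  have l3 := (mem_slitPlane_iff_arg.1 s3).1.lt_of_le (arg_le_pi _)
  have g1 := neg_pi_lt_arg ((b - p) / (a - p))
  have g2 := neg_pi_lt_arg ((a - p) / (0 - p))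
  have g3 := neg_pi_lt_arg ((0 - p) / (b - p))
  have hang : ((arg ((b - p) / (a - p)) + arg ((a - p) / (0 - p)) + arg ((0 - p) / (b - p)) : ℝ) : Real.Angle) = 0 := by
    rw [Real.Angle.coe_add, Real.Angle.coe_add, arg_div_coe_angle nb na, arg_div_coe_angle na n0,
      arg_div_coe_angle n0 nb]
    abel
  have c2 : cr (0 - p) (a - p) = cr a p := by simp [cr]; ring
  have c3 : cr (b - p) (0 - p) = cr p b := by simp [cr]; ring
  have c1' : cr (b - p) (a - p) = - cr (a - p) (b - p) := by simp [cr]; ring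
  have c2' : cr p a = - cr a p := by simp [cr]; ring
  have c3' : cr b p = - cr p b := by simp [cr]; ring
  have i1 := im_pos_iff_cr (b := b - p) na
  have i2 := im_pos_iff_cr (b := a - p) n0
  have i3 := im_pos_iff_cr (b := 0 - p) nb
  have j1 := im_neg_iff_cr (b := b - p) na
  have j2 := im_neg_iff_cr (b := a - p) n0
  have j3 := im_neg_iff_cr (b := 0 - p) nb
  rw [c2] at i2 j2
  rw [c3] at i3 j3
  set x := (b - p) / (a - p)
  set y := (a - p) / (0 - p)
  set z := (0 - p) / (b - p)
  by_cases hT : p ∈ Tri a b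
  · have hT' : p ∉ Tri b a := by
      rintro ⟨k1, k2, k3⟩
      rw [c1'] at k1; linarith [hT.1]
    rw [Set.indicator_of_mem hT, Set.indicator_of_notMem hT']
    have a1 := arg_pos_of_im (i1.2 hT.1)
    have a2 := arg_pos_of_im (i2.2 hT.2.2)
    have a3 := arg_pos_of_im (i3.2 hT.2.1)
    have := eq_zero_of_angle (x := arg x + arg y + arg z - 2 * Real.pi) (by
      rw [Real.Angle.coe_sub, hang]; simp) (by linarith) (by linarith)
    linarith
  by_cases hT' : p ∈ Tri b a
  · rw [Set.indicator_of_mem hT', Set.indicator_of_notMem hT]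
    obtain ⟨k1, k2, k3⟩ := hT'
    rw [c1'] at k1
    rw [c2'] at k2
    rw [c3'] at k3
    have a1 := arg_neg_iff.2 (j1.2 (by linarith))
    have a2 := arg_neg_iff.2 (j2.2 (by linarith))
    have a3 := arg_neg_iff.2 (j3.2 (by linarith))
    have := eq_zero_of_angle (x := arg x + arg y + arg z + 2 * Real.pi) (by
      rw [Real.Angle.coe_add, hang]; simp) (by linarith) (by linarith)
    linarith
  · rw [Set.indicator_of_notMem hT', Set.indicator_of_notMem hT]
    rw [sub_self, mul_zero]
    apply eq_zero_of_angle hang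
    · by_contra hc
      have := eq_zero_of_angle (x := arg x + arg y + arg z + 2 * Real.pi) (by
        rw [Real.Angle.coe_add, hang]; simp) (by linarith) (by linarith)
      apply hT'
      have a1 := j1.1 (arg_neg_iff.1 (by linarith : arg x < 0))
      have a2 := j2.1 (arg_neg_iff.1 (by linarith : arg y < 0))
      have a3 := j3.1 (arg_neg_iff.1 (by linarith : arg z < 0))
      refine ⟨by rw [c1']; linarith, by rw [c2']; linarith, by rw [c3']; linarith⟩
    · by_contra hc
      have := eq_zero_of_angle (x := arg x + arg y + arg z - 2 * Real.pi) (by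
        rw [Real.Angle.coe_sub, hang]; simp) (by linarith) (by linarith)
      apply hT
      have a1 := i1.1 (im_pos_of_arg (by linarith : 0 < arg x) l1)
      have a2 := i2.1 (im_pos_of_arg (by linarith : 0 < arg y) l2)
      have a3 := i3.1 (im_pos_of_arg (by linarith : 0 < arg z) l3)
      exact ⟨a1, a3, a2⟩

theorem W_tri {n : ℕ} {v : ℕ → ℂ} (hv : v n = v 0) {p : ℂ} (hp : p ∉ Bd n v)
    (h2 : ∀ i, p ∉ segment ℝ 0 (v i)) :
    W n v p = 2 * Real.pi * ∑ i ∈ Finset.range n, ((Tri (v i) (v (i + 1))).indicator (fun _ => (1:ℝ)) p -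
      (Tri (v (i + 1)) (v i)).indicator (fun _ => (1:ℝ)) p) := by
  rw [Finset.mul_sum]
  have key : ∀ i ∈ Finset.range n, arg ((v (i + 1) - p) / (v i - p)) =
      2 * Real.pi * ((Tri (v i) (v (i + 1))).indicator (fun _ => (1:ℝ)) p -
      (Tri (v (i + 1)) (v i)).indicator (fun _ => (1:ℝ)) p) +
      (arg ((v (i + 1) - p) / (0 - p)) - arg ((v i - p) / (0 - p))) := by
    intro i hi
    have h3 : p ∉ segment ℝ (v (i + 1)) 0 := by rw [segment_symm]; exact h2 _
    rw [← tri_arg (fun hm => hp (mem_Bd.2 ⟨i, Finset.mem_range.1 hi, hm⟩)) (h2 i) h3]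
    have e : (0 - p) / (v (i + 1) - p) = ((v (i + 1) - p) / (0 - p))⁻¹ := by simp
    rw [e, arg_inv, if_neg (mem_slitPlane_iff_arg.1 (slit_of_not_mem_segment (h2 (i + 1)))).1]
    ring
  unfold W
  rw [Finset.sum_congr rfl key, Finset.sum_add_distrib,
    Finset.sum_range_sub (fun i => arg ((v i - p) / (0 - p))), hv, sub_self, add_zero]

theorem area_nonpos {n : ℕ} {v : ℕ → ℂ} (h : Poly n v) (hcv : cv n v = 0) :
    ∑ i ∈ Finset.range n, cr (v i) (v (i + 1)) ≤ 0 := by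
  have hper0 : v n = v 0 := by simpa using h.per 0
  set f : ℂ → ℝ := fun p => ∑ i ∈ Finset.range n, ((Tri (v i) (v (i + 1))).indicator (fun _ => (1:ℝ)) p -
      (Tri (v (i + 1)) (v i)).indicator (fun _ => (1:ℝ)) p) with hf
  have hintg : ∫ p, f p = (∑ i ∈ Finset.range n, cr (v i) (v (i + 1))) * (volume Std).toReal := by
    rw [hf, integral_finsetSum, Finset.sum_mul]
    · refine Finset.sum_congr rfl fun i _ => ?_
      rw [integral_sub (Tri_int _ _).1 (Tri_int _ _).1, (Tri_int _ _).2, (Tri_int _ _).2, ← sub_mul]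
      congr 1
      have : cr (v (i + 1)) (v i) = - cr (v i) (v (i + 1)) := by simp [cr]; ring
      rw [this]
      rcases le_total 0 (cr (v i) (v (i + 1))) with h1 | h1
      · rw [max_eq_left h1, max_eq_right (by linarith)]; ring
      · rw [max_eq_right h1, max_eq_left (by linarith)]; ring
    · intro i _
      exact (Tri_int _ _).1.sub (Tri_int _ _).1
  have hae : ∀ᵐ p : ℂ, f p ≤ 0 := by
    have a1 : ∀ᵐ p : ℂ, ∀ i, p ∉ segment ℝ 0 (v i) :=
      ae_all_iff.2 fun i => measure_eq_zero_iff_ae_notMem.1 (seg_null _ _)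
    have a2 : ∀ᵐ p : ℂ, ∀ i, p ∉ segment ℝ (v i) (v (i + 1)) :=
      ae_all_iff.2 fun i => measure_eq_zero_iff_ae_notMem.1 (seg_null _ _)
    have a3 : ∀ᵐ p : ℂ, ∀ i, p ∉ {z : ℂ | z.im = (v i).im} :=
      ae_all_iff.2 fun i => measure_eq_zero_iff_ae_notMem.1 (horiz_null _)
    filter_upwards [a1, a2, a3] with p h1 h2 h3
    have hp : p ∉ Bd n v := by
      intro hm
      obtain ⟨i, _, hi⟩ := mem_Bd.1 hm
      exact h2 i hi
    have hW := W_tri hper0 hp h1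
    have hpi := Real.pi_pos
    have : W n v p ≤ 0 := by
      rcases W_values h hp (fun i hi => h3 i hi) with h4 | h4 | h4 <;> rw [h4] <;> linarith
    rw [hW] at this
    by_contra hc
    have hc : 0 < f p := not_le.1 hc
    have : 0 < 2 * Real.pi * f p := by positivity
    simp only [hf] at this
    linarith
  have h1 : ∫ p, f p ≤ 0 := integral_nonpos_of_ae hae
  rw [hintg] at h1
  have h2 : 0 < (volume Std).toReal := ENNReal.toReal_pos Std_pos.ne' Std_fin.ne
  by_contra hc
  have := mul_pos (not_le.1 hc) h2
  linarith

/-- positive area forces the constant to be `2π` -/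
theorem cv_of_area {n : ℕ} {v : ℕ → ℂ} (h : Poly n v)
    (ha : 0 < ∑ i ∈ Finset.range n, cr (v i) (v (i + 1))) : cv n v = 2 * Real.pi := by
  obtain ⟨j, hj, hl⟩ := exists_lexmin h (ω := 1) one_ne_zero
  rcases hull_sign_shift h j 1 hl with h1 | h1
  · exact h1.1
  · have := area_nonpos h h1.1
    linarith

end FP


namespace FP
open Complex

theorem par_of_cr {a b : ℂ} (ha : a ≠ 0) (h : cr a b = 0) : ∃ t : ℝ, b = t * a := by
  refine ⟨(b / a).re, ?_⟩
  rw [← div_eq_iff ha]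
  apply Complex.ext
  · simp
  · rw [div_im_cr, h]; simp

theorem Chain.inj_le {k : ℕ} {u : ℕ → ℂ} (h : Chain k u) {i j : ℕ} (hij : i < j) (hj : j ≤ k) :
    u j ≠ u i := by
  intro he
  obtain ⟨d, rfl⟩ : ∃ d, j = i + 1 + d := ⟨j - (i + 1), by omega⟩
  match d with
  | 0 => exact h.ne i (by omega) he
  | 1 =>
    have := h.nospike i (by omega)
    rw [show i + 2 = i + 1 + 1 by ring, he, ← neg_sub, neg_div,
      div_self (sub_ne_zero.2 (h.ne i (by omega)))] at this
    rw [mem_slitPlane_iff] at this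
    simp at this
    linarith
  | d + 2 =>
    have := h.nonadj i (i + 1 + (d + 1)) (by omega) (by omega)
    refine Set.disjoint_left.1 this (left_mem_segment ℝ _ _) ?_
    rw [← he]
    exact right_mem_segment ℝ _ _

theorem chain_tri {k : ℕ} {u : ℕ → ℂ} (h : Chain k u) (Y : ℂ)
    (hD : 0 < cr (u k - u 0) (Y - u 0))
    (hα : ∀ i ≤ k, 0 ≤ cr (u k - u 0) (u i - u 0))
    (hβ : ∀ i ≤ k, 0 ≤ cr (Y - u k) (u i - u k))
    (hγ : ∀ i ≤ k, 0 ≤ cr (u 0 - Y) (u i - Y)) :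
    (∀ j < k, ∀ i ≤ k, cr (u (j + 1) - u j) (u i - u j) ≤ 0) ∧
    ∀ j < k, 0 ≤ cr (u (j + 1) - u j) (Y - u j) := by
  have hBY : u k - Y ≠ 0 := by
    intro h0
    rw [sub_eq_zero.1 h0] at hD
    simp [cr] at hD
    linarith
  have hAY : u 0 - Y ≠ 0 := by
    intro h0
    rw [sub_eq_zero.1 h0] at hD
    simp [cr] at hD
  have hAB : u k - u 0 ≠ 0 := by
    intro h0
    rw [h0] at hD
    simp [cr] at hD
  have hl : ∀ i < k, LexPos ((u k - u i) / (u k - Y)) := by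
    intro i hi
    have e : cr (u k - Y) (u k - u i) = cr (Y - u k) (u i - u k) := by simp [cr]; ring
    have hb := hβ i hi.le
    rw [← e] at hb
    rcases hb.lt_or_eq with h1 | h1
    · left; rwa [im_pos_iff_cr hBY]
    · right
      obtain ⟨t, ht⟩ := par_of_cr hBY h1.symm
      rw [ht, mul_div_cancel_right₀ _ hBY]
      refine ⟨by simp, ?_⟩
      rw [ofReal_re]
      have ha := hα i hi.le
      have e2 : cr (u k - u 0) (u i - u 0) = t * cr (u k - u 0) (Y - u 0) := by
        have : u i - u 0 = (u k - u 0) - t * (u k - Y) := by rw [← ht]; ring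
        rw [this]; simp [cr]; ring
      rw [e2] at ha
      have h2 : 0 ≤ t := nonneg_of_mul_nonneg_left ha hD
      rcases h2.lt_or_eq with h3 | h3
      · exact h3
      · exfalso
        rw [← h3, ofReal_zero, zero_mul] at ht
        exact h.inj_le hi le_rfl (sub_eq_zero.1 ht)
  have hl' : ∀ i, 0 < i → i ≤ k →
      LexPos (((starRingEnd ℂ) (u 0 - u i)) / (starRingEnd ℂ) (u 0 - Y)) := by
    intro i hi0 hi
    rw [← map_div₀]
    have e : cr (u 0 - Y) (u 0 - u i) = - cr (u 0 - Y) (u i - Y) := by simp [cr]; ring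
    have hb := hγ i hi
    rcases hb.lt_or_eq with h1 | h1
    · left
      rw [conj_im, neg_pos, im_neg_iff_cr hAY, e]; linarith
    · right
      rw [← h1, neg_zero] at e
      obtain ⟨t, ht⟩ := par_of_cr hAY e
      rw [ht, mul_div_cancel_right₀ _ hAY, conj_ofReal]
      refine ⟨by simp, ?_⟩
      rw [ofReal_re]
      have ha := hα i hi
      have e2 : cr (u k - u 0) (u i - u 0) = t * cr (u k - u 0) (Y - u 0) := by
        have : u i - u 0 = - (t * (u 0 - Y)) := by rw [← ht]; ring
        rw [this]; simp [cr]; ring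
      rw [e2] at ha
      have h2 : 0 ≤ t := nonneg_of_mul_nonneg_left ha hD
      rcases h2.lt_or_eq with h3 | h3
      · exact h3
      · exfalso
        rw [← h3, ofReal_zero, zero_mul] at ht
        exact h.inj_le hi0 hi (sub_eq_zero.1 ht).symm
  have hR := chain_right h _ _ hl hl'
  refine ⟨hR, fun j hj => ?_⟩
  by_contra hneg
  rw [not_le] at hneg
  have hA := hR j hj 0 (by omega)
  have hB := hR j hj k le_rfl
  have key : ∀ p : ℂ, cr (u k - u 0) (Y - u 0) * cr (u (j + 1) - u j) (p - u j) =
      cr (u k - u 0) (p - u 0) * cr (u (j + 1) - u j) (Y - u j) +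
      cr (Y - u k) (p - u k) * cr (u (j + 1) - u j) (u 0 - u j) +
      cr (u 0 - Y) (p - Y) * cr (u (j + 1) - u j) (u k - u j) := by
    intro p; simp [cr]; ring
  have zero : ∀ i ≤ k, cr (u (j + 1) - u j) (u i - u j) = 0 → cr (u k - u 0) (u i - u 0) = 0 := by
    intro i hi h0
    have := key (u i)
    rw [h0, mul_zero] at this
    have a1 := mul_nonpos_of_nonneg_of_nonpos (hβ i hi) hA
    have a2 := mul_nonpos_of_nonneg_of_nonpos (hγ i hi) hB
    rcases (hα i hi).lt_or_eq with h1 | h1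
    · have := mul_neg_of_pos_of_neg h1 hneg
      linarith
    · exact h1.symm
  have z0 := zero j hj.le (by simp [cr])
  have z1 := zero (j + 1) hj (by simp [cr]; ring)
  obtain ⟨σ, hσ⟩ := par_of_cr hAB z0
  obtain ⟨τ, hτ⟩ := par_of_cr hAB z1
  have hd : u (j + 1) - u j = ((τ - σ : ℝ) : ℂ) * (u k - u 0) := by
    push_cast; linear_combination hτ - hσ
  have hY : cr (u (j + 1) - u j) (Y - u j) = (τ - σ) * cr (u k - u 0) (Y - u 0) := by
    have : Y - u j = (Y - u 0) - σ * (u k - u 0) := by linear_combination -hσ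
    rw [hd, this]; simp [cr]; ring
  have hs : τ - σ < 0 := by
    rw [hY] at hneg
    by_contra hc
    have := mul_nonneg (not_lt.1 hc) hD.le
    linarith
  have hτ0 : 0 ≤ τ := by
    have := hγ (j + 1) hj
    have e : u (j + 1) - Y = (u 0 - Y) + τ * (u k - u 0) := by linear_combination hτ
    have e2 : cr (u 0 - Y) (u (j + 1) - Y) = τ * cr (u k - u 0) (Y - u 0) := by
      rw [e]; simp [cr]; ring
    rw [e2] at this
    exact nonneg_of_mul_nonneg_left this hD
  have hσ0 : 0 < σ := by linarith
  have hj0 : 0 < j := by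
    rcases Nat.eq_zero_or_pos j with h1 | h1
    · exfalso
      subst h1
      rw [sub_self] at hσ
      have : (σ : ℂ) = 0 := by
        rcases mul_eq_zero.1 hσ.symm with h2 | h2
        · exact h2
        · exact absurd h2 hAB
      have : σ = 0 := by exact_mod_cast this
      linarith
    · exact h1
  have := chain_lex h _ hl j hj 0 hj0
  rw [hσ, hd, mul_div_mul_right _ _ hAB, ← ofReal_div] at this
  have hneg : σ / (τ - σ) < 0 := div_neg_of_pos_of_neg hσ0 hs
  rcases this with h1 | h1
  · simp only [ofReal_im] at h1; linarith
  · rw [ofReal_re] at h1; linarith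

/-- sub-chain of a polygon -/
theorem Poly.chain {n : ℕ} {v : ℕ → ℂ} (h : Poly n v) (s K : ℕ) (hK : K + 2 ≤ n)
    (ht : ∀ i, i + 2 ≤ K → cr (v (s + (i + 1)) - v (s + i)) (v (s + (i + 2)) - v (s + (i + 1))) ≤ 0) :
    Chain K (fun i => v (s + i)) where
  ne i hi := by
    intro he
    exact h.edge_ne (s + i) (sub_eq_zero.2 he)
  turn i hi := ht i hi
  nospike i hi := h.nospike (s + i)
  nonadj i j h1 h2 := by
    have := h.nonadj (s + i) (j - i) (by omega) (by omega)
    rw [show s + i + (j - i) = s + j by omega] at this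
    exact this

theorem per_all {n : ℕ} {v : ℕ → ℂ} (h : Poly n v) {j : ℕ} (hj : j < n) {Q : ℂ → Prop}
    (hQ : ∀ i < n, Q (v (j + i))) (i : ℕ) : Q (v i) := by
  have hp : Function.Periodic v n := h.per
  have hn := h.hn
  rw [← hp.map_mod_nat i]
  have hlt : i % n < n := Nat.mod_lt _ (by omega)
  rcases Nat.lt_or_ge (i % n) j with h1 | h1
  · rw [← h.per, show i % n + n = j + (i % n + n - j) by omega]
    exact hQ _ (by omega)
  · rw [show i % n = j + (i % n - j) by omega]
    exact hQ _ (by omega)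

theorem hull_min {n : ℕ} {v : ℕ → ℂ} (h : Poly n v) (hcv : cv n v = 2 * Real.pi) {k : ℕ}
    (hconv : ∀ j < n, 0 < cr (v j - v (j + (n - 1))) (v (j + 1) - v j) → j = 0 ∨ j = 1 ∨ j = k)
    {ω : ℂ} (hω : ω ≠ 0) :
    ∃ j, (j = 0 ∨ j = 1 ∨ j = k) ∧ ∀ i, 0 ≤ cr ω (v i - v j) := by
  obtain ⟨j, hj, hl⟩ := exists_lexmin h hω
  have hpi := Real.pi_pos
  refine ⟨j, ?_, ?_⟩
  · rcases hull_sign_shift h j ω hl with h1 | h1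
    · exact hconv j hj h1.2
    · linarith [h1.1]
  · refine per_all h hj (Q := fun z => 0 ≤ cr ω (z - v j)) ?_
    intro i hi
    rcases Nat.eq_zero_or_pos i with rfl | h0
    · simp [cr]
    · have h2 : 0 ≤ ((v (j + i) - v j) / ω).im := by
        rcases hl i h0 hi with h1 | h1
        · exact h1.le
        · exact h1.1.ge
      rw [div_im_cr] at h2
      by_contra hc
      have := div_neg_of_neg_of_pos (not_le.1 hc) (normSq_pos.2 hω)
      linarith

/-- the special point on the base -/
theorem exists_base_point {n : ℕ} {v : ℕ → ℂ} (h : Poly n v) (hcv : cv n v = 2 * Real.pi) {k : ℕ}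
    (hk : 2 ≤ k) (hkn : k + 1 ≤ n)
    (hconv : ∀ j < n, 0 < cr (v j - v (j + (n - 1))) (v (j + 1) - v j) ↔ j = 0 ∨ j = 1 ∨ j = k) :
    ∃ t : ℝ, 0 < t ∧ t < 1 ∧
      ∀ i < n, 0 ≤ cr (v (i + 1) - v i) (v 0 + t * (v 1 - v 0) - v i) := by
  have hn := h.hn
  have hper0 : v n = v 0 := by simpa using h.per 0
  have hmin := fun {ω : ℂ} => hull_min h hcv (fun j hj => (hconv j hj).1) (ω := ω)
  have hlr : v 1 - v 0 ≠ 0 := h.edge_ne 0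
  have cl : 0 < cr (v 1 - v 0) (v (n - 1) - v 0) := by
    have := (hconv 0 (by omega)).2 (Or.inl rfl)
    rw [zero_add, zero_add] at this
    convert this using 1
    simp [cr]; ring
  have hD : 0 < cr (v 1 - v 0) (v k - v 0) := by
    obtain ⟨j, hj, hm⟩ := hmin (ω := -(v 1 - v 0)) (neg_ne_zero.2 hlr)
    have h1 := hm (n - 1)
    have e : ∀ z, cr (-(v 1 - v 0)) (v (n - 1) - z) =
      cr (v 1 - v 0) (z - v 0) - cr (v 1 - v 0) (v (n - 1) - v 0) := by
      intro z; simp [cr]; ring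
    rw [e] at h1
    rcases hj with rfl | rfl | rfl
    · exfalso
      have : cr (v 1 - v 0) (v 0 - v 0) = 0 := by simp [cr]
      linarith
    · exfalso
      have : cr (v 1 - v 0) (v 1 - v 0) = 0 := by simp [cr]; ring
      linarith
    · linarith
  have H1 : ∀ i, 0 ≤ cr (v 1 - v 0) (v i - v 0) := by
    obtain ⟨j, hj, hm⟩ := hmin (ω := (v 1 - v 0)) hlr
    intro i
    rcases hj with rfl | rfl | rfl
    · exact hm i
    · convert hm i using 1; simp [cr]; ring
    · exfalso
      have := hm 0
      have e : cr (v 1 - v 0) (v 0 - v j) = - cr (v 1 - v 0) (v j - v 0) := by simp [cr]; ring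
      linarith
  have H2 : ∀ i, 0 ≤ cr (v k - v 1) (v i - v 1) := by
    have hne : v k - v 1 ≠ 0 := by
      intro h0
      rw [sub_eq_zero.1 h0] at hD
      simp [cr] at hD; linarith
    obtain ⟨j, hj, hm⟩ := hmin (ω := (v k - v 1)) hne
    intro i
    rcases hj with rfl | rfl | rfl
    · exfalso
      have := hm 1
      have e : cr (v k - v 1) (v 1 - v 0) = - cr (v 1 - v 0) (v k - v 0) := by simp [cr]; ring
      linarith
    · exact hm i
    · convert hm i using 1; simp [cr]; ring
  have H3 : ∀ i, 0 ≤ cr (v 0 - v k) (v i - v k) := by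
    have hne : v 0 - v k ≠ 0 := by
      intro h0
      rw [← sub_eq_zero.1 h0] at hD
      simp [cr] at hD
    obtain ⟨j, hj, hm⟩ := hmin (ω := (v 0 - v k)) hne
    intro i
    rcases hj with rfl | rfl | rfl
    · convert hm i using 1; simp [cr]; ring
    · exfalso
      have := hm k
      have e : cr (v 0 - v k) (v k - v 1) = - cr (v 1 - v 0) (v k - v 0) := by simp [cr]; ring
      linarith
    · exact hm i
  -- the chains
  have turn : ∀ j, j + 1 < n → j + 1 ≠ 1 → j + 1 ≠ k →
      cr (v (j + 1) - v j) (v (j + 2) - v (j + 1)) ≤ 0 := by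
    intro j h1 h2 h3
    by_contra hc
    rw [not_le] at hc
    have := (hconv (j + 1) h1).1 (by
      rw [show j + 1 + (n - 1) = j + n by omega, h.per]; exact hc)
    omega
  have hcR : Chain (k - 1) (fun i => v (1 + i)) := by
    refine h.chain 1 (k - 1) (by omega) ?_
    intro i hi
    exact turn (1 + i) (by omega) (by omega) (by omega)
  have hcL : Chain (n - k) (fun i => v (k + i)) := by
    refine h.chain k (n - k) (by omega) ?_
    intro i hi
    exact turn (k + i) (by omega) (by omega) (by omega)
  have ek : 1 + (k - 1) = k := by omega
  have en : k + (n - k) = n := by omega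
  -- apply to opposite corner
  have R1 := fun (Y : ℂ) (hD : 0 < cr (v k - v 1) (Y - v 1))
      (hβ : ∀ i, 1 ≤ i → i ≤ k → 0 ≤ cr (Y - v k) (v i - v k))
      (hγ : ∀ i, 1 ≤ i → i ≤ k → 0 ≤ cr (v 1 - Y) (v i - Y)) => chain_tri hcR Y
    (by simp only [ek, add_zero]; exact hD)
    (by intro i hi; simp only [ek, add_zero]; exact H2 _)
    (by intro i hi; simp only [ek]; exact hβ _ (by omega) (by omega))
    (by intro i hi; simp only [add_zero]; exact hγ _ (by omega) (by omega))
  have L1 := fun (Y : ℂ) (hD : 0 < cr (v 0 - v k) (Y - v k))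
      (hβ : ∀ i, k ≤ i → i ≤ n → 0 ≤ cr (Y - v 0) (v i - v 0))
      (hγ : ∀ i, k ≤ i → i ≤ n → 0 ≤ cr (v k - Y) (v i - Y)) => chain_tri hcL Y
    (by simp only [en, hper0, add_zero]; exact hD)
    (by intro i hi; simp only [en, hper0, add_zero]; exact H3 _)
    (by intro i hi; simp only [en, hper0]; exact hβ _ (by omega) (by omega))
    (by intro i hi; simp only [add_zero]; exact hγ _ (by omega) (by omega))
  have R0 := (R1 (v 0) (by convert hD using 1; simp [cr]; ring) (fun i _ _ => H3 i)
    (fun i _ _ => H1 i)).1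
  have L0 := (L1 (v 1) (by convert hD using 1; simp [cr]; ring) (fun i _ _ => H1 i)
    (fun i _ _ => H2 i)).1
  have R0' : ∀ i, 1 ≤ i → i ≤ k → 0 ≤ cr (v (k - 1) - v k) (v i - v k) := by
    intro i h1 h2
    have := R0 (k - 2) (by omega) (i - 1) (by omega)
    rw [show 1 + (k - 2 + 1) = k by omega, show 1 + (k - 2) = k - 1 by omega,
      show 1 + (i - 1) = i by omega] at this
    simp only [cr, sub_re, sub_im] at *; linarith
  have L0' : ∀ i, k ≤ i → i ≤ n → cr (v (k + 1) - v k) (v i - v k) ≤ 0 := by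
    intro i h1 h2
    have := L0 0 (by omega) (i - k) (by omega)
    rw [show k + (i - k) = i by omega] at this
    exact this
  -- coordinates
  set D := cr (v 1 - v 0) (v k - v 0) with hDdef
  have coord : ∀ z : ℂ, (D : ℂ) * (z - v k) = (cr (v k - v 1) (z - v 1) : ℝ) * (v 0 - v k) +
      (cr (v 0 - v k) (z - v k) : ℝ) * (v 1 - v k) := by
    intro z
    rw [hDdef]
    apply Complex.ext
    · simp only [add_re, re_ofReal_mul]; simp [cr]; ring
    · simp only [add_im, im_ofReal_mul]; simp [cr]; ring
  have ca : 0 < cr (v (k + 1) - v k) (v (k - 1) - v k) := by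
    have := (hconv k (by omega)).2 (Or.inr (Or.inr rfl))
    rw [show k + (n - 1) = k - 1 + n by omega, h.per] at this
    convert this using 1
    simp [cr]; ring
  obtain ⟨α, hα⟩ : ∃ α, α = cr (v k - v 1) (v (k - 1) - v 1) := ⟨_, rfl⟩
  obtain ⟨β, hβ⟩ : ∃ β, β = cr (v 0 - v k) (v (k - 1) - v k) := ⟨_, rfl⟩
  obtain ⟨α', hα'⟩ : ∃ α', α' = cr (v k - v 1) (v (k + 1) - v 1) := ⟨_, rfl⟩
  obtain ⟨β', hβ'⟩ : ∃ β', β' = cr (v 0 - v k) (v (k + 1) - v k) := ⟨_, rfl⟩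
  have hq := coord (v (k - 1))
  have hq' := coord (v (k + 1))
  rw [← hα, ← hβ] at hq
  rw [← hα', ← hβ'] at hq'
  have α0 : 0 ≤ α := hα ▸ H2 _
  have β0 : 0 ≤ β := hβ ▸ H3 _
  have α'0 : 0 ≤ α' := hα' ▸ H2 _
  have β'0 : 0 ≤ β' := hβ' ▸ H3 _
  have hcross : 0 < α' * β - β' * α := by
    have e : D * cr (v (k + 1) - v k) (v (k - 1) - v k) = α' * β - β' * α := by
      rw [hα, hβ, hα', hβ', hDdef]; simp [cr]; ring
    rw [← e]; exact mul_pos hD ca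
  have hβp : 0 < β := by
    rcases β0.lt_or_eq with h1 | h1
    · exact h1
    · rw [← h1] at hcross
      have := mul_nonneg β'0 α0
      linarith
  have hα'p : 0 < α' := by
    rcases α'0.lt_or_eq with h1 | h1
    · exact h1
    · rw [← h1] at hcross
      have := mul_nonneg β'0 α0
      linarith
  obtain ⟨t, t0, t1, ta, tb⟩ : ∃ t : ℝ, 0 < t ∧ t < 1 ∧ t * α ≤ (1 - t) * β ∧
      (1 - t) * β' ≤ t * α' := by
    refine ⟨(β / (α + β) + β' / (α' + β')) / 2, by positivity, ?_, ?_, ?_⟩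
    · have h1 : β / (α + β) ≤ 1 := by rw [div_le_one (by positivity)]; linarith
      have h2 : β' / (α' + β') < 1 := by rw [div_lt_one (by positivity)]; linarith
      linarith
    · have h1 : β' / (α' + β') ≤ β / (α + β) := by
        rw [div_le_div_iff₀ (by positivity) (by positivity)]; nlinarith
      have h2 : (β / (α + β) + β' / (α' + β')) / 2 ≤ β / (α + β) := by linarith
      have h3 : β / (α + β) * (α + β) = β := by field_simp
      have h4 := mul_le_mul_of_nonneg_right h2 (by positivity : 0 ≤ α + β)
      linarith
    · have h1 : β' / (α' + β') ≤ β / (α + β) := by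
        rw [div_le_div_iff₀ (by positivity) (by positivity)]; nlinarith
      have h2 : β' / (α' + β') ≤ (β / (α + β) + β' / (α' + β')) / 2 := by linarith
      have h3 : β' / (α' + β') * (α' + β') = β' := by field_simp
      have h4 := mul_le_mul_of_nonneg_right h2 (by positivity : 0 ≤ α' + β')
      linarith
  refine ⟨t, t0, t1, ?_⟩
  obtain ⟨x, hx⟩ : ∃ x, x = v 0 + t * (v 1 - v 0) := ⟨_, rfl⟩
  rw [← hx]
  have hqre := congrArg re hq
  have hqim := congrArg im hq
  have hqre' := congrArg re hq'
  have hqim' := congrArg im hq'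
  simp only [add_re, add_im, re_ofReal_mul, im_ofReal_mul] at hqre hqim hqre' hqim'
  have xre : x.re = (v 0).re + t * ((v 1).re - (v 0).re) := by rw [hx]; simp
  have xim : x.im = (v 0).im + t * ((v 1).im - (v 0).im) := by rw [hx]; simp
  have RX := (R1 x (by
      have e : cr (v k - v 1) (x - v 1) = (1 - t) * D := by
        rw [hDdef]; simp only [cr, sub_re, sub_im, xre, xim]; ring
      rw [e]; apply mul_pos _ hD; linarith)
    (by
      intro i h1 h2
      have e : β * cr (x - v k) (v i - v k) = ((1 - t) * β - t * α) * cr (v 0 - v k) (v i - v k) +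
          t * D * cr (v (k - 1) - v k) (v i - v k) := by
        simp only [cr, sub_re, sub_im, xre, xim] at hqre hqim hqre' hqim' ⊢
        linear_combination (-t * ((v i).im - (v k).im)) * hqre + (t * ((v i).re - (v k).re)) * hqim
      have := mul_nonneg (sub_nonneg.2 ta) (H3 i)
      have := mul_nonneg (mul_nonneg t0.le hD.le) (R0' i h1 h2)
      refine le_of_mul_le_mul_left (a := β) ?_ hβp
      rw [mul_zero]; linarith)
    (by
      intro i h1 h2
      have e : cr (v 1 - x) (v i - x) = (1 - t) * cr (v 1 - v 0) (v i - v 0) := by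
        simp only [cr, sub_re, sub_im, xre, xim]; ring
      rw [e]; exact mul_nonneg (by linarith) (H1 i))).2
  have LX := (L1 x (by
      have e : cr (v 0 - v k) (x - v k) = t * D := by
        rw [hDdef]; simp only [cr, sub_re, sub_im, xre, xim]; ring
      rw [e]; exact mul_pos t0 hD)
    (by
      intro i h1 h2
      have e : cr (x - v 0) (v i - v 0) = t * cr (v 1 - v 0) (v i - v 0) := by
        simp only [cr, sub_re, sub_im, xre, xim]; ring
      rw [e]; exact mul_nonneg (by linarith) (H1 i))
    (by
      intro i h1 h2
      have e : α' * cr (v k - x) (v i - x) = (t * α' - (1 - t) * β') * cr (v k - v 1) (v i - v 1) +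
          (1 - t) * D * (- cr (v (k + 1) - v k) (v i - v k)) := by
        simp only [cr, sub_re, sub_im, xre, xim] at hqre hqim hqre' hqim' ⊢
        linear_combination ((1 - t) * ((v i).im - (v k).im)) * hqre' +
          (-(1 - t) * ((v i).re - (v k).re)) * hqim'
      have := mul_nonneg (sub_nonneg.2 tb) (H2 i)
      have := mul_nonneg (mul_nonneg (sub_nonneg.2 t1.le) hD.le) (neg_nonneg.2 (L0' i h1 h2))
      refine le_of_mul_le_mul_left (a := α') ?_ hα'p
      rw [mul_zero]; linarith)).2
  intro i hi
  rcases Nat.eq_zero_or_pos i with rfl | hi0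
  · have e : cr (v (0 + 1) - v 0) (x - v 0) = 0 := by
      simp only [zero_add, cr, sub_re, sub_im, xre, xim]; ring
    rw [e]
  rcases Nat.lt_or_ge i k with h1 | h1
  · have := RX (i - 1) (by omega)
    rw [show 1 + (i - 1 + 1) = i + 1 by omega, show 1 + (i - 1) = i by omega] at this
    exact this
  · have := LX (i - k) (by omega)
    rw [show k + (i - k + 1) = i + 1 by omega, show k + (i - k) = i by omega] at this
    exact this

end FP


namespace FP
open Complex

theorem cr_div (a b c : ℂ) : cr (a / c) (b / c) = cr a b / normSq c := by
  unfold cr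
  by_cases hc : c = 0
  · simp [hc]
  have : normSq c ≠ 0 := (normSq_pos.2 hc).ne'
  simp only [div_re, div_im]
  field_simp
  rw [normSq_apply]; ring

theorem neg_axis_arg {z : ℂ} (h : z.im = 0) (h' : z.re < 0) : arg z = Real.pi :=
  arg_eq_pi_iff.2 ⟨h', h⟩

theorem per_edge {n : ℕ} {v : ℕ → ℂ} (hn : 0 < n) (per : ∀ i, v (i + n) = v i) {Q : ℂ → ℂ → Prop}
    (hQ : ∀ i < n, Q (v i) (v (i + 1))) (i : ℕ) : Q (v i) (v (i + 1)) := by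
  have hp : Function.Periodic v n := per
  have hp1 : Function.Periodic (fun i => v (i + 1)) n := by
    intro i
    simp only
    rw [show i + n + 1 = i + 1 + n by ring]; exact per _
  rw [← hp.map_mod_nat i]
  have := hp1.map_mod_nat i
  rw [← this]
  exact hQ _ (Nat.mod_lt _ hn)

/-- points behind the guard have nonzero winding number -/
theorem W_ne_zero {n : ℕ} {v : ℕ → ℂ} (hn : 0 < n) (per : ∀ i, v (i + n) = v i) {x s b : ℂ}
    {t : ℝ} (t0 : 0 < t) (t1 : t < 1) (hx : x = v 0 + t * (v 1 - v 0))
    (hleft : ∀ i < n, 0 ≤ cr (v (i + 1) - v i) (x - v i))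
    (hs : s ∉ Bd n v) (hxs : x - s ≠ 0) (hb : b ∈ Bd n v) {lam : ℝ} (hl : 0 < lam)
    (hbs : b - s = -(lam * (x - s))) : W n v s ≠ 0 := by
  intro hW
  have hpi := Real.pi_pos
  have hper0 : v n = v 0 := by simpa using per 0
  obtain ⟨z, hz⟩ : ∃ z : ℕ → ℂ, z = fun i => (v i - s) / (x - s) := ⟨_, rfl⟩
  have hvz : ∀ i, (v i - s) = z i * (x - s) := by
    intro i; rw [hz]; field_simp
  have hratio : ∀ i, (v (i + 1) - s) / (v i - s) = z (i + 1) / z i := by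
    intro i; rw [hvz, hvz, mul_div_mul_right _ _ hxs]
  have slit0 : ∀ i, (v (i + 1) - s) / (v i - s) ∈ slitPlane :=
    per_edge hn per (Q := fun a b => (b - s) / (a - s) ∈ slitPlane) fun i hi => slit_of_not_Bd hs hi
  have slit : ∀ i, z (i + 1) / z i ∈ slitPlane := fun i => by rw [← hratio]; exact slit0 i
  have zne : ∀ i, z i ≠ 0 := fun i => slit_den_ne (slit i)
  have hH : ∀ i, 0 ≤ cr (z i) (z (i + 1)) - ((z (i + 1)).im - (z i).im) := by
    intro i
    have h1 := per_edge hn per (Q := fun a b => 0 ≤ cr (b - a) (x - a)) hleft i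
    have h2 : 0 ≤ cr ((v (i + 1) - v i) / (x - s)) ((x - v i) / (x - s)) := by
      rw [cr_div]; exact div_nonneg h1 (normSq_nonneg _)
    have e1 : (v (i + 1) - v i) / (x - s) = z (i + 1) - z i := by
      rw [hz]; simp only; ring
    have e2 : (x - v i) / (x - s) = 1 - z i := by
      rw [hz]; field_simp; ring
    rw [e1, e2] at h2
    have e3 : cr (z (i + 1) - z i) (1 - z i) = cr (z i) (z (i + 1)) - ((z (i + 1)).im - (z i).im) := by
      simp [cr]; ring
    rwa [e3] at h2
  have crneg : ∀ i, arg (z (i + 1) / z i) < 0 → cr (z i) (z (i + 1)) < 0 := fun i h =>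
    (im_neg_iff_cr (zne i)).1 (arg_neg_iff.1 h)
  have crnonneg : ∀ i, 0 ≤ arg (z (i + 1) / z i) → 0 ≤ cr (z i) (z (i + 1)) := fun i h => by
    by_contra hc
    have := arg_neg_iff.2 ((im_neg_iff_cr (zne i)).2 (not_le.1 hc))
    linarith
  have ltpi : ∀ i, arg (z (i + 1) / z i) < Real.pi := fun i =>
    (mem_slitPlane_iff_arg.1 (slit i)).1.lt_of_le (arg_le_pi _)
  have eang : ∀ i, ((arg (z (i + 1) / z i) - (arg (z (i + 1)) - arg (z i)) : ℝ) : Real.Angle) = 0 := by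
    intro i
    rw [Real.Angle.coe_sub, Real.Angle.coe_sub, arg_div_coe_angle (zne _) (zne _), sub_self]
  have enn : ∀ i, 0 ≤ arg (z (i + 1) / z i) - (arg (z (i + 1)) - arg (z i)) := by
    intro i
    by_contra hc
    rw [not_le] at hc
    have g1 := neg_pi_lt_arg (z (i + 1) / z i)
    have g2 := neg_pi_lt_arg (z (i + 1))
    have g3 := neg_pi_lt_arg (z i)
    have l2 := arg_le_pi (z (i + 1))
    have l3 := arg_le_pi (z i)
    have l1 := ltpi i
    have h2 : arg (z (i + 1) / z i) - (arg (z (i + 1)) - arg (z i)) + 2 * Real.pi = 0 := by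
      apply eq_zero_of_angle
      · rw [Real.Angle.coe_add, eang]; simp
      · linarith
      · linarith
    have k1 : (z i).im < 0 := arg_neg_iff.1 (by linarith)
    have k2 : 0 ≤ (z (i + 1)).im := arg_nonneg_iff.1 (by linarith)
    have k3 := crneg i (by linarith)
    have := hH i
    linarith
  have hsum : ∑ i ∈ Finset.range n, (arg (z (i + 1) / z i) - (arg (z (i + 1)) - arg (z i))) = 0 := by
    rw [Finset.sum_sub_distrib, Finset.sum_range_sub (fun i => arg (z i))]
    have : z n = z 0 := by rw [hz]; simp only [hper0]
    rw [this, sub_self, sub_zero, ← hW]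
    unfold W
    exact Finset.sum_congr rfl fun i _ => by rw [hratio]
  have eall0 : ∀ i < n, arg (z (i + 1) / z i) = arg (z (i + 1)) - arg (z i) := by
    intro i hi
    have := (Finset.sum_eq_zero_iff_of_nonneg (fun i _ => enn i)).1 hsum i (Finset.mem_range.2 hi)
    linarith
  have zper : ∀ i, z (i + n) = z i := by
    intro i; rw [hz]; simp only [per]
  have eall : ∀ i, arg (z (i + 1) / z i) = arg (z (i + 1)) - arg (z i) :=
    per_edge hn zper (Q := fun a b => arg (b / a) = arg b - arg a) eall0
  -- step
  have step : ∀ i, arg (z i) = Real.pi → arg (z (i + 1)) = Real.pi := by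
    intro i hi
    have h1 := eall i
    have l2 := arg_le_pi (z (i + 1))
    rcases l2.lt_or_eq with h2 | h2
    · exfalso
      have h3 := crneg i (by linarith)
      obtain ⟨h4, h5⟩ := arg_eq_pi_iff.1 hi
      have h6 := hH i
      have h7 : cr (z i) (z (i + 1)) = (z i).re * (z (i + 1)).im := by
        unfold cr; rw [h5]; ring
      rw [h5] at h6
      rw [h7] at h3 h6
      have h8 : 0 < (z (i + 1)).im := by
        by_contra hc
        have := mul_nonneg_of_nonpos_of_nonpos h4.le (not_lt.1 hc)
        linarith
      linarith
    · exact h2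
  -- a vertex on the negative axis
  have hex : ∃ m, arg (z m) = Real.pi := by
    obtain ⟨m, hm, hbm⟩ := mem_Bd.1 hb
    rw [segment_eq_image'] at hbm
    obtain ⟨τ, ⟨τ0, τ1⟩, hτ⟩ := hbm
    simp only [real_smul] at hτ
    have hcomb : (1 - (τ : ℂ)) * z m + τ * z (m + 1) = -(lam : ℂ) := by
      apply mul_right_cancel₀ hxs
      rw [add_mul, mul_assoc, mul_assoc, ← hvz, ← hvz]
      linear_combination hτ + hbs
    have hre := congrArg re hcomb
    have him := congrArg im hcomb
    rw [← ofReal_one, ← ofReal_sub, add_re, re_ofReal_mul, re_ofReal_mul, neg_re, ofReal_re] at hre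
    rw [← ofReal_one, ← ofReal_sub, add_im, im_ofReal_mul, im_ofReal_mul, neg_im, ofReal_im, neg_zero] at him
    have hcr : τ * cr (z m) (z (m + 1)) = lam * (z m).im := by
      unfold cr
      linear_combination (z m).re * him - (z m).im * hre
    rcases lt_trichotomy (z m).im 0 with h1 | h1 | h1
    · exfalso
      have h2 : 0 ≤ (z (m + 1)).im := by
        by_contra hc
        rw [not_le] at hc
        rcases τ0.lt_or_eq with h3 | h3
        · nlinarith
        · rw [← h3] at him; linarith
      have a1 := arg_neg_iff.2 h1
      have a2 := arg_nonneg_iff.2 h2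
      have := crnonneg m (by rw [eall]; linarith)
      have := mul_nonneg τ0 this
      nlinarith
    · rcases eq_or_ne τ 0 with h3 | h3
      · refine ⟨m, neg_axis_arg h1 ?_⟩
        rw [h3] at hre; linarith
      · have h4 : (z (m + 1)).im = 0 := by
          rw [h1, mul_zero, zero_add] at him
          exact (mul_eq_zero.1 him).resolve_left h3
        by_cases h5 : (z m).re < 0
        · exact ⟨m, neg_axis_arg h1 h5⟩
        · refine ⟨m + 1, neg_axis_arg h4 ?_⟩
          by_contra hc
          have := mul_nonneg τ0 (not_lt.1 hc)
          have := mul_nonneg (sub_nonneg.2 τ1) (not_lt.1 h5)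
          linarith
    · have h2 : (z (m + 1)).im ≤ 0 := by
        by_contra hc
        rw [not_le] at hc
        rcases τ0.lt_or_eq with h3 | h3
        · nlinarith
        · rw [← h3] at him; linarith
      rcases h2.lt_or_eq with h3 | h3
      · exfalso
        have a1 := arg_neg_iff.2 h3
        have a2 := arg_pos_of_im h1
        have := crneg m (by rw [eall]; linarith)
        have := mul_nonpos_of_nonneg_of_nonpos τ0 this.le
        nlinarith
      · refine ⟨m + 1, neg_axis_arg h3 ?_⟩
        have h4 : 1 - τ = 0 := by
          rw [h3, mul_zero, add_zero] at him
          exact (mul_eq_zero.1 him).resolve_right h1.ne'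
        rw [h4, zero_mul, zero_add, show τ = 1 by linarith] at hre
        linarith
  obtain ⟨m, hm⟩ := hex
  have hall : ∀ j, arg (z (m + j)) = Real.pi := by
    intro j
    induction j with
    | zero => exact hm
    | succ j ih => exact step _ ih
  have hzp : ∀ i, arg (z i) = Real.pi := by
    intro i
    have hp : Function.Periodic z n := zper
    have := hp.nat_mul m i
    rw [← this]
    obtain ⟨d, hd⟩ : ∃ d, i + m * n = m + d := ⟨i + m * n - m, by
      have := Nat.le_mul_of_pos_right m hn
      omega⟩
    have e : ((m : ℕ) : ℕ) * n = m * n := rfl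
    simp only [Nat.cast_id]
    rw [hd]; exact hall d
  have hcomb : (1 - (t : ℂ)) * z 0 + t * z 1 = 1 := by
    apply mul_right_cancel₀ hxs
    rw [add_mul, mul_assoc, mul_assoc, ← hvz, ← hvz]
    rw [hx]; ring
  have hre := congrArg re hcomb
  rw [← ofReal_one, ← ofReal_sub, add_re, re_ofReal_mul, re_ofReal_mul, ofReal_re] at hre
  have b0 := (arg_eq_pi_iff.1 (hzp 0)).1
  have b1 := (arg_eq_pi_iff.1 (hzp 1)).1
  nlinarith

/-- visibility, complex version -/
theorem sees_aux {n : ℕ} {v : ℕ → ℂ} (hn : 0 < n) (per : ∀ i, v (i + n) = v i) {x : ℂ}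
    {t : ℝ} (t0 : 0 < t) (t1 : t < 1) (hx : x = v 0 + t * (v 1 - v 0))
    (hleft : ∀ i < n, 0 ≤ cr (v (i + 1) - v i) (x - v i)) {p s : ℂ}
    (hp : p ∈ Bd n v ∨ (p ∉ Bd n v ∧ Bornology.IsBounded (connectedComponentIn (Bd n v)ᶜ p)))
    (hsp : s ∈ segment ℝ x p) :
    s ∈ Bd n v ∨ (s ∉ Bd n v ∧ Bornology.IsBounded (connectedComponentIn (Bd n v)ᶜ s)) := by
  by_cases hs : s ∈ Bd n v
  · exact Or.inl hs
  refine Or.inr ⟨hs, ?_⟩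
  have hper0 : v n = v 0 := by simpa using per 0
  have hxB : x ∈ Bd n v := by
    refine mem_Bd.2 ⟨0, hn, ?_⟩
    rw [segment_eq_image']
    exact ⟨t, ⟨t0.le, t1.le⟩, by simp [hx]⟩
  have hxs : x - s ≠ 0 := by
    intro h0
    apply hs; rw [← sub_eq_zero.1 h0]; exact hxB
  obtain ⟨c, hc0, hcp⟩ : ∃ c : ℝ, 0 ≤ c ∧ p = s + c * (s - x) := by
    rw [segment_eq_image'] at hsp
    obtain ⟨τ, ⟨τ0, τ1⟩, hτ⟩ := hsp
    simp only [real_smul] at hτ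
    have hτ0 : τ ≠ 0 := by
      intro h0
      rw [h0] at hτ
      apply hxs; rw [← hτ]; simp
    have hτc : (τ : ℂ) ≠ 0 := by exact_mod_cast hτ0
    refine ⟨(1 - τ) / τ, div_nonneg (by linarith) τ0, ?_⟩
    push_cast
    field_simp
    linear_combination hτ
  have hhit : ∃ c : ℝ, 0 ≤ c ∧ s + c * (s - x) ∈ Bd n v := by
    by_contra hno
    push Not at hno
    rcases hp with hp | ⟨hp, hbd⟩
    · exact hno c hc0 (hcp ▸ hp)
    · have hpre : IsPreconnected ((fun c : ℝ => s + c * (s - x)) '' Set.Ici 0) :=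
        isPreconnected_Ici.image _ (by fun_prop)
      have hsub := hpre.subset_connectedComponentIn (x := p) (F := (Bd n v)ᶜ)
        ⟨c, hc0, hcp.symm⟩ (by
          rintro _ ⟨c, hc, rfl⟩
          exact hno c hc)
      obtain ⟨R, hR⟩ := (hbd.subset hsub).exists_norm_le
      have hnpos : 0 < ‖s - x‖ := by
        rw [norm_pos_iff, ← neg_sub]; exact neg_ne_zero.2 hxs
      obtain ⟨c1, hc1⟩ : ∃ c1 : ℝ, c1 = (‖s‖ + |R| + 1) / ‖s - x‖ := ⟨_, rfl⟩
      have hc10 : 0 ≤ c1 := by rw [hc1]; positivity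
      have h1 := hR _ ⟨c1, hc10, rfl⟩
      have h2 : ‖(c1 : ℂ) * (s - x)‖ = ‖s‖ + |R| + 1 := by
        rw [norm_mul, norm_real, Real.norm_of_nonneg hc10, hc1]; field_simp
      have h3 := norm_sub_le (s + c1 * (s - x)) s
      rw [add_sub_cancel_left, h2] at h3
      have := le_abs_self R
      simp only at h1
      linarith
  obtain ⟨lam, hl0, hb⟩ := hhit
  have hl : 0 < lam := by
    rcases hl0.lt_or_eq with h1 | h1
    · exact h1
    · exfalso; rw [← h1] at hb; apply hs; simpa using hb
  have hW := W_ne_zero hn per t0 t1 hx hleft hs hxs hb hl (by ring)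
  obtain ⟨R, hR⟩ := W_far hper0
  refine (Metric.isBounded_closedBall (x := (0:ℂ)) (r := R)).subset ?_
  intro q hq
  rw [mem_closedBall_zero_iff]
  by_contra hc
  apply hW
  rw [← hR q (not_le.1 hc)]
  exact W_const hn hper0 isPreconnected_connectedComponentIn
    (fun y hy => connectedComponentIn_subset _ _ hy) (mem_connectedComponentIn hs) hq

end FP


namespace FP
open Complex

theorem slit_of_seg {a b c : ℂ} (hab : a ≠ b) (hbc : b ≠ c)
    (h : segment ℝ a b ∩ segment ℝ b c ⊆ {b}) : (c - b) / (b - a) ∈ slitPlane := by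
  by_contra hs
  obtain ⟨τ, hτ0, he⟩ := not_slit hs
  have hba : b - a ≠ 0 := sub_ne_zero.2 hab.symm
  rw [div_eq_iff hba] at he
  rcases le_total τ 1 with h1 | h1
  · have : c ∈ segment ℝ a b := by
      refine ⟨τ, 1 - τ, hτ0, by linarith, by ring, ?_⟩
      simp only [real_smul]; push_cast
      linear_combination -he
    exact hbc (h ⟨this, right_mem_segment ℝ _ _⟩).symm
  · have hτc : (τ : ℂ) ≠ 0 := by exact_mod_cast (by linarith : τ ≠ 0)
    have : a ∈ segment ℝ b c := by
      refine ⟨1 - 1 / τ, 1 / τ, ?_, by positivity, by ring, ?_⟩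
      · rw [sub_nonneg, div_le_one (by linarith)]; exact h1
      · simp only [real_smul]; push_cast; field_simp
        linear_combination he
    exact hab (h ⟨left_mem_segment ℝ _ _, this⟩)

/-- identification of the plane with `ℂ` -/
noncomputable def ph : (ℝ × ℝ) ≃L[ℝ] ℂ := equivRealProdCLM.symm

theorem ph_re (p : ℝ × ℝ) : (ph p).re = p.1 := by simp [ph]

theorem ph_im (p : ℝ × ℝ) : (ph p).im = p.2 := by simp [ph]

theorem ph_seg (a b : ℝ × ℝ) : ph '' segment ℝ a b = segment ℝ (ph a) (ph b) := by
  have := image_segment ℝ (ph : (ℝ × ℝ) →L[ℝ] ℂ).toLinearMap.toAffineMap a b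
  exact this

theorem ph_cr (a b : ℝ × ℝ) : cr (ph a) (ph b) = SimplePolygon.cross2 a b := by
  simp [cr, SimplePolygon.cross2, ph_re, ph_im]

theorem ofNat_add {n : ℕ} [NeZero n] (i j : ℕ) : Fin.ofNat n (i + j) = Fin.ofNat n i + Fin.ofNat n j := by
  apply Fin.ext; simp [Fin.val_add]

theorem ofNat_self (n : ℕ) [NeZero n] : Fin.ofNat n n = 0 := by
  apply Fin.ext; simp

theorem ofNat_one (n : ℕ) [NeZero n] : Fin.ofNat n 1 = 1 := by
  apply Fin.ext; simp [Fin.val_one']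

theorem ofNat_inj {n : ℕ} [NeZero n] {i j : ℕ} (hi : i < n) (hj : j < n)
    (h : Fin.ofNat n i = Fin.ofNat n j) : i = j := by
  have := congrArg Fin.val h
  simpa [Nat.mod_eq_of_lt hi, Nat.mod_eq_of_lt hj] using this

theorem ofNat_val {n : ℕ} [NeZero n] (i : Fin n) : Fin.ofNat n i.val = i := by
  apply Fin.ext; simp [Nat.mod_eq_of_lt i.2]

/-- the periodic vertex sequence, starting at `b` -/
noncomputable def sq (P : SimplePolygon) (b : Fin P.n) (i : ℕ) : ℂ :=
  ph (P.vtx (b + Fin.ofNat P.n i))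

theorem sq_succ (P : SimplePolygon) (b : Fin P.n) (i : ℕ) :
    sq P b (i + 1) = ph (P.vtx (b + Fin.ofNat P.n i + 1)) := by
  unfold sq
  rw [ofNat_add, ofNat_one, add_assoc]

theorem sq_poly (P : SimplePolygon) (b : Fin P.n) : Poly P.n (sq P b) where
  hn := P.three_le
  per i := by
    unfold sq
    rw [ofNat_add, ofNat_self, add_zero]
  nospike i := by
    have h3 := P.three_le
    have e2 : sq P b (i + 2) = ph (P.vtx (b + Fin.ofNat P.n i + 1 + 1)) := by
      rw [show i + 2 = (i + 1) + 1 by ring, sq_succ, ofNat_add, ofNat_one, ← add_assoc]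
    rw [e2, sq_succ]
    change (_ - _) / (_ - ph (P.vtx (b + Fin.ofNat P.n i))) ∈ slitPlane
    set j := b + Fin.ofNat P.n i
    have hne : ∀ j : Fin P.n, j ≠ j + 1 := by
      intro j hj
      have h0 : (1 : Fin P.n) = 0 := by
        have := hj.symm
        rwa [add_eq_left] at this
      rw [← ofNat_one] at h0
      have := ofNat_inj (n := P.n) (i := 1) (j := 0) (by omega) (by omega) (by rw [h0]; rfl)
      omega
    apply slit_of_seg
    · intro h; exact hne j (P.inj (ph.injective h))
    · intro h; exact hne (j + 1) (P.inj (ph.injective h))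
    · have h1 : segment ℝ (P.vtx j) (P.vtx (j + 1)) ∩ segment ℝ (P.vtx (j + 1)) (P.vtx (j + 1 + 1))
        = {P.vtx (j + 1)} := P.consec_edges j
      rw [← ph_seg, ← ph_seg, ← Set.image_inter ph.injective, h1, Set.image_singleton]
  nonadj i k hk hkn := by
    have h3 := P.three_le
    rw [sq_succ, sq_succ]
    change Disjoint (segment ℝ (ph (P.vtx (b + Fin.ofNat P.n i))) _)
      (segment ℝ (ph (P.vtx (b + Fin.ofNat P.n (i + k)))) _)
    rw [ofNat_add, ← add_assoc]
    set j := b + Fin.ofNat P.n i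
    have h1 : segment ℝ (P.vtx j) (P.vtx (j + 1)) ∩
        segment ℝ (P.vtx (j + Fin.ofNat P.n k)) (P.vtx (j + Fin.ofNat P.n k + 1)) = ∅ := by
      apply P.nonconsec_edges
      · intro h
        have h0 : Fin.ofNat P.n k = Fin.ofNat P.n 0 := by
          have := h.symm
          rw [add_eq_left] at this
          rw [this]; rfl
        have := ofNat_inj (by omega) (by omega) h0
        omega
      · intro h
        have h0 : Fin.ofNat P.n k = Fin.ofNat P.n 1 := by
          rw [ofNat_one]; exact add_left_cancel h
        have := ofNat_inj (by omega) (by omega) h0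
        omega
      · intro h
        have h0 : Fin.ofNat P.n (k + 1) = Fin.ofNat P.n 0 := by
          have := h.symm
          rw [add_assoc, add_eq_left] at this
          rw [ofNat_add, ofNat_one]
          rw [this]; rfl
        have := ofNat_inj (by omega) (by omega) h0
        omega
    rw [← ph_seg, ← ph_seg, Set.disjoint_iff_inter_eq_empty, ← Set.image_inter ph.injective, h1,
      Set.image_empty]

theorem sq_Bd (P : SimplePolygon) (b : Fin P.n) (p : ℝ × ℝ) :
    ph p ∈ Bd P.n (sq P b) ↔ p ∈ P.boundary := by
  have key : ∀ i, ph p ∈ segment ℝ (sq P b i) (sq P b (i + 1)) ↔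
      p ∈ segment ℝ (P.vtx (b + Fin.ofNat P.n i)) (P.vtx (b + Fin.ofNat P.n i + 1)) := by
    intro i
    rw [sq_succ]
    unfold sq
    rw [← ph_seg, ph.injective.mem_set_image]
  rw [mem_Bd, SimplePolygon.boundary, Set.mem_iUnion]
  constructor
  · rintro ⟨i, _, hi⟩
    exact ⟨_, (key i).1 hi⟩
  · rintro ⟨j, hj⟩
    refine ⟨(j - b).val, (j - b).2, (key _).2 ?_⟩
    rw [ofNat_val, add_sub_cancel]
    exact hj

theorem sq_Bd_image (P : SimplePolygon) (b : Fin P.n) :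
    ph '' (P.boundaryᶜ) = (Bd P.n (sq P b))ᶜ := by
  ext z
  obtain ⟨p, rfl⟩ := ph.surjective z
  rw [ph.injective.mem_set_image, Set.mem_compl_iff, Set.mem_compl_iff, sq_Bd]

theorem sq_region (P : SimplePolygon) (b : Fin P.n) (p : ℝ × ℝ) :
    p ∈ P.region ↔ (ph p ∈ Bd P.n (sq P b) ∨ (ph p ∉ Bd P.n (sq P b) ∧
      Bornology.IsBounded (connectedComponentIn (Bd P.n (sq P b))ᶜ (ph p)))) := by
  unfold SimplePolygon.region
  rw [sq_Bd]
  refine or_congr Iff.rfl (and_congr_right fun hp => ?_)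
  have := ph.toHomeomorph.image_connectedComponentIn (s := P.boundaryᶜ) (x := p) hp
  have h2 : ph '' (connectedComponentIn P.boundaryᶜ p) =
      connectedComponentIn (Bd P.n (sq P b))ᶜ (ph p) := by
    rw [← sq_Bd_image]; exact this
  rw [← h2]
  constructor
  · intro h
    exact (ph : (ℝ × ℝ) →L[ℝ] ℂ).lipschitz.isBounded_image h
  · intro h
    have := (ph.symm : ℂ →L[ℝ] (ℝ × ℝ)).lipschitz.isBounded_image h
    rw [Set.image_image] at this
    simpa using this

theorem sq_area (P : SimplePolygon) (b : Fin P.n) (hccw : P.Ccw) :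
    0 < ∑ i ∈ Finset.range P.n, cr (sq P b i) (sq P b (i + 1)) := by
  unfold SimplePolygon.Ccw at hccw
  rw [← Equiv.sum_comp (Equiv.addLeft b)] at hccw
  rw [Finset.sum_range]
  convert hccw using 1
  refine Finset.sum_congr rfl fun i _ => ?_
  rw [sq_succ, sq, ofNat_val, ph_cr]
  rfl

theorem sq_conv (P : SimplePolygon) (b : Fin P.n) (j : ℕ) :
    cr (sq P b j - sq P b (j + (P.n - 1))) (sq P b (j + 1) - sq P b j) > 0 ↔
      P.ConvexVtx (b + Fin.ofNat P.n j) := by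
  have h3 := P.three_le
  rw [sq_succ]
  unfold sq SimplePolygon.ConvexVtx
  rw [← map_sub, ← map_sub, ph_cr]
  have : b + Fin.ofNat P.n (j + (P.n - 1)) = b + Fin.ofNat P.n j - 1 := by
    rw [eq_sub_iff_add_eq, add_assoc, ← ofNat_one, ← ofNat_add, add_assoc,
      Nat.sub_add_cancel (by omega), ofNat_add, ofNat_self, add_zero]
  rw [this]

end FP

theorem funnel_base_point_sees_all (P : SimplePolygon) (hccw : P.Ccw)
    (b c : Fin P.n) (hc1 : c ≠ b) (hc2 : c ≠ b + 1)
    (hconv : {i : Fin P.n | P.ConvexVtx i} = {b, b + 1, c}) :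
    ∃ x ∈ segment ℝ (P.vtx b) (P.vtx (b + 1)), ∀ p ∈ P.region, P.Sees x p := by
  have h3 := P.three_le
  have hP := FP.sq_poly P b
  have hcv := FP.cv_of_area hP (FP.sq_area P b hccw)
  obtain ⟨k, hk⟩ : ∃ k, k = (c - b).val := ⟨_, rfl⟩
  have hkn : k < P.n := hk ▸ (c - b).2
  have hck : c = b + Fin.ofNat P.n k := by rw [hk, FP.ofNat_val, add_sub_cancel]
  have hk0 : k ≠ 0 := by
    intro h0
    apply hc1
    rw [hck, h0]
    change b + 0 = b
    rw [add_zero]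
  have hk1 : k ≠ 1 := by
    intro h0
    apply hc2
    rw [hck, h0, FP.ofNat_one]
  have hcx : ∀ j < P.n, 0 < FP.cr (FP.sq P b j - FP.sq P b (j + (P.n - 1)))
      (FP.sq P b (j + 1) - FP.sq P b j) ↔ j = 0 ∨ j = 1 ∨ j = k := by
    intro j hj
    have h1 : P.ConvexVtx (b + Fin.ofNat P.n j) ↔
        b + Fin.ofNat P.n j ∈ ({b, b + 1, c} : Set (Fin P.n)) := by
      rw [← hconv]; rfl
    rw [← gt_iff_lt, FP.sq_conv, h1, hck]
    simp only [Set.mem_insert_iff, Set.mem_singleton_iff]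
    have e0 : b = b + Fin.ofNat P.n 0 := by change b = b + 0; rw [add_zero]
    constructor
    · rintro (h | h | h)
      · left
        rw [add_eq_left] at h
        exact FP.ofNat_inj hj (by omega) (by rw [h]; rfl)
      · right; left
        exact FP.ofNat_inj hj (by omega) (by rw [add_left_cancel h, FP.ofNat_one])
      · right; right
        exact FP.ofNat_inj hj hkn (add_left_cancel h)
    · rintro (h | h | h)
      · left; rw [h]; exact e0.symm
      · right; left; rw [h, FP.ofNat_one]
      · right; right; rw [h]
  obtain ⟨t, t0, t1, hleft⟩ := FP.exists_base_point hP hcv (by omega) (by omega) hcx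
  obtain ⟨x, hx⟩ := FP.ph.surjective (FP.sq P b 0 + t * (FP.sq P b 1 - FP.sq P b 0))
  have hs0 : FP.sq P b 0 = FP.ph (P.vtx b) := by
    unfold FP.sq
    change FP.ph (P.vtx (b + 0)) = _
    rw [add_zero]
  have hs1 : FP.sq P b 1 = FP.ph (P.vtx (b + 1)) := by
    unfold FP.sq
    rw [FP.ofNat_one]
  refine ⟨x, ?_, ?_⟩
  · rw [← FP.ph.injective.mem_set_image, FP.ph_seg, hx, segment_eq_image', ← hs0, ← hs1]
    exact ⟨t, ⟨t0.le, t1.le⟩, by simp⟩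
  · intro p hp s hs
    rw [FP.sq_region P b] at hp ⊢
    refine FP.sees_aux (by omega) hP.per t0 t1 hx (by rw [hx]; exact hleft) hp ?_
    rw [← FP.ph_seg]
    exact Set.mem_image_of_mem _ hs
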